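/- For every ε ∈ (0,1) there is a constant c₅(ε) depending only on d ≥ 3 and ε such that: for every integer L ≥ 1, every integer K ≥ c₅(ε) with K ≥ 100, and every nonempty finite subset 𝒞 of 𝕃 = Lℤ^d whose points are at mutual ℓ∞-distance at least (2K+3)L, setting C = ∪_{z∈𝒞} D_z and V(x) = Σ_{z∈𝒞} e_C(D_z)·ē_{D_z}(x) (where e_C(D_z) = Σ_{y∈D_z} e_C(y)), one has V(x) ≤ (1+ε)·e_C(x) for all x ∈ ℤ^d. -/

import Mathlib

open MeasureTheory ENNReal Set
open scoped Classical NNReal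

namespace Disconnection

/-- Points of `ℤ^d`. -/
abbrev Zd (d : ℕ) := Fin d → ℤ

/-- Step distribution of the simple random walk: uniform weight `1/(2d)` on each of the
`2d` unit vectors of `ℤ^d`. -/
noncomputable def stepP (d : ℕ) (v : Zd d) : ℝ≥0∞ :=
  if (∑ i, (v i).natAbs) = 1 then ((2 * d : ℕ) : ℝ≥0∞)⁻¹ else 0

/-- The exponential distribution of rate `1` on `[0,∞)` (as a measure on `ℝ`). -/
noncomputable def expMeasure : Measure ℝ :=
  MeasureTheory.volume.withDensity fun t => ENNReal.ofReal (if 0 < t then Real.exp (-t) else 0)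

/-- Nearest neighbours in `ℤ^d` (Euclidean distance one). -/
def adjacent {d : ℕ} (x y : Zd d) : Prop := (∑ i, (x i - y i).natAbs) = 1

/-- (Outer) boundary `∂A` of a set `A ⊆ ℤ^d`. -/
def bdry {d : ℕ} (A : Set (Zd d)) : Set (Zd d) := {y | y ∉ A ∧ ∃ x ∈ A, adjacent x y}

/-- sup-norm distance between two points of `ℤ^d`. -/
def supDist {d : ℕ} (x y : Zd d) : ℕ := Finset.univ.sup fun i => (x i - y i).natAbs

/-- closed sup-norm ball `B(x,r)` in `ℤ^d`. -/
def ball {d : ℕ} (x : Zd d) (r : ℕ) : Set (Zd d) := {y | supDist x y ≤ r}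

/-- mutual sup-norm distance between two sets. -/
noncomputable def setDist {d : ℕ} (A B : Set (Zd d)) : ℕ := sInf {n | ∃ x ∈ A, ∃ y ∈ B, supDist x y = n}

/-- the box `ℤ^d ∩ [a,b)^d`. -/
def intBox {d : ℕ} (a b : ℤ) : Set (Zd d) := {y | ∀ i, a ≤ y i ∧ y i < b}

/-- A box in `ℤ^d`: a translate of `[0,L)^d ∩ ℤ^d` with `L ≥ 1`. -/
def isBox {d : ℕ} (S : Set (Zd d)) : Prop :=
  ∃ L : ℕ, 1 ≤ L ∧ ∃ a : Zd d, S = {y | ∀ i, a i ≤ y i ∧ y i < a i + L}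

/-- connectedness of a subset of `ℤ^d` by nearest-neighbour paths. -/
def connSet {d : ℕ} (S : Set (Zd d)) : Prop :=
  ∀ a ∈ S, ∀ b ∈ S, ∃ (n : ℕ) (f : ℕ → Zd d), f 0 = a ∧ f n = b ∧
    (∀ k ≤ n, f k ∈ S) ∧ ∀ k < n, adjacent (f k) (f (k + 1))

/-- Euclidean norm of a lattice point. -/
noncomputable def eucNorm {d : ℕ} (x : Zd d) : ℝ := Real.sqrt (∑ i, ((x i : ℝ)) ^ 2)

/-- A model of the continuous-time simple random walk on `ℤ^d` with unit jump rate: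
`Y` is the discrete jump chain and `ζ` are the holding times; under `P x` one has
`Y 0 = x` a.s., and the increments of `Y` together with the holding times are mutually
independent, the increments uniform on the `2d` unit vectors and the holding times
exponential of rate `1`.  This is expressed through the finite-dimensional cylinder
probabilities, which determine the joint law. -/
structure SRW (d : ℕ) (Ω : Type*) [MeasurableSpace Ω] where
  P : Zd d → Measure Ω
  isProb : ∀ x, IsProbabilityMeasure (P x)
  Y : ℕ → Ω → Zd d
  ζ : ℕ → Ω → ℝ
  measurable_Y : ∀ n, Measurable (Y n)
  measurable_ζ : ∀ n, Measurable (ζ n)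
  Y_zero : ∀ x : Zd d, P x {ω | Y 0 ω = x} = 1
  law : ∀ (x : Zd d) (n : ℕ) (s : Fin n → Zd d) (I : Fin n → Set ℝ),
    (∀ i, MeasurableSet (I i)) →
    P x {ω | (∀ i : Fin n, Y ((i : ℕ) + 1) ω - Y (i : ℕ) ω = s i) ∧
             (∀ i : Fin n, ζ (i : ℕ) ω ∈ I i)}
      = (∏ i, stepP d (s i)) * ∏ i, expMeasure (I i)

namespace SRW

variable {d : ℕ} {Ω : Type*} [MeasurableSpace Ω]

/-- time of the `n`-th jump. -/
noncomputable def S (W : SRW d Ω) (n : ℕ) (ω : Ω) : ℝ := ∑ i ∈ Finset.range n, W.ζ i ω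

/-- index of the current step of the jump chain at time `t`. -/
noncomputable def jumpIdx (W : SRW d Ω) (t : ℝ) (ω : Ω) : ℕ := sSup {k : ℕ | W.S k ω ≤ t}

/-- the continuous-time walk `X_t`. -/
noncomputable def X (W : SRW d Ω) (t : ℝ) (ω : Ω) : Zd d := W.Y (W.jumpIdx t ω) ω

/-- entrance time of `A` after time `t` (`∞` if there is none). -/
noncomputable def hitFrom (W : SRW d Ω) (A : Set (Zd d)) (t : ℝ≥0∞) (ω : Ω) : ℝ≥0∞ :=
  sInf {u : ℝ≥0∞ | ∃ s : ℝ≥0, u = (s : ℝ≥0∞) ∧ t ≤ u ∧ W.X (s : ℝ) ω ∈ A}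

/-- entrance time `H_A = inf {t ≥ 0 : X_t ∈ A}`. -/
noncomputable def hit (W : SRW d Ω) (A : Set (Zd d)) (ω : Ω) : ℝ≥0∞ := W.hitFrom A 0 ω

/-- exit time `T_U = inf {t ≥ 0 : X_t ∉ U}`. -/
noncomputable def exit (W : SRW d Ω) (U : Set (Zd d)) (ω : Ω) : ℝ≥0∞ := W.hit Uᶜ ω

/-- hitting time `H̃_A = inf {t ≥ ζ₀ : X_t ∈ A}`. -/
noncomputable def hitTilde (W : SRW d Ω) (A : Set (Zd d)) (ω : Ω) : ℝ≥0∞ :=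
  W.hitFrom A (ENNReal.ofReal (W.ζ 0 ω)) ω

/-- the walk evaluated at a random (possibly infinite) time. -/
noncomputable def Xat (W : SRW d Ω) (τ : Ω → ℝ≥0∞) (ω : Ω) : Zd d := W.X (τ ω).toReal ω

/-- equilibrium measure `e_A(x) = P_x[H̃_A = ∞] 1_A(x)`. -/
noncomputable def eqm (W : SRW d Ω) (A : Set (Zd d)) (x : Zd d) : ℝ :=
  if x ∈ A then (W.P x {ω | W.hitTilde A ω = ⊤}).toReal else 0

/-- capacity `cap(A) = Σ_x e_A(x)`. -/
noncomputable def cap (W : SRW d Ω) (A : Set (Zd d)) : ℝ := ∑ᶠ x, W.eqm A x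

/-- normalized equilibrium measure `ē_A = e_A / cap(A)`. -/
noncomputable def ebar (W : SRW d Ω) (A : Set (Zd d)) (x : Zd d) : ℝ := W.eqm A x / W.cap A

/-- equilibrium measure of `A` relative to `U`: `e_{A,U}(x) = P_x[H̃_A > T_U] 1_A(x)`. -/
noncomputable def eqmRel (W : SRW d Ω) (A U : Set (Zd d)) (x : Zd d) : ℝ :=
  if x ∈ A then (W.P x {ω | W.exit U ω < W.hitTilde A ω}).toReal else 0

/-- `P_ρ = Σ_x ρ(x) P_x`, the walk started from the initial (sub-)measure with density `ρ`. -/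
noncomputable def Pinit (W : SRW d Ω) (ρ : Zd d → ℝ) : Measure Ω :=
  Measure.sum fun x : Zd d => ENNReal.ofReal (ρ x) • W.P x

/-- Green function `g(x,y) = E_x[∫₀^∞ 1{X_s = y} ds]`. -/
noncomputable def green (W : SRW d Ω) (x y : Zd d) : ℝ :=
  ∫ ω, (∫ s in Set.Ioi (0 : ℝ), if W.X s ω = y then (1 : ℝ) else 0) ∂ W.P x

/-- killed Green function `g_U(x,y) = E_x[∫₀^{T_U} 1{X_s = y} ds]`. -/
noncomputable def greenK (W : SRW d Ω) (U : Set (Zd d)) (x y : Zd d) : ℝ :=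
  ∫ ω, (∫ s in Set.Ioi (0 : ℝ),
      if ENNReal.ofReal s < W.exit U ω ∧ W.X s ω = y then (1 : ℝ) else 0) ∂ W.P x

/-- the potential operator `Gf(x) = Σ_y g(x,y) f(y)`. -/
noncomputable def Gop (W : SRW d Ω) (f : Zd d → ℝ) (x : Zd d) : ℝ :=
  ∑ᶠ y, W.green x y * f y

/-- successive return times to `A` (between excursions out of `U`): `Rt A U 0 = R₁ = H_A`. -/
noncomputable def Rt (W : SRW d Ω) (A U : Set (Zd d)) : ℕ → Ω → ℝ≥0∞
  | 0 => W.hit A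
  | k + 1 => fun ω => W.hitFrom A (W.hitFrom Uᶜ (W.Rt A U k ω) ω) ω

/-- successive departure times from `U`: `Dt A U k = D_{k+1}`. -/
noncomputable def Dt (W : SRW d Ω) (A U : Set (Zd d)) (k : ℕ) (ω : Ω) : ℝ≥0∞ :=
  W.hitFrom Uᶜ (W.Rt A U k ω) ω

/-- number of excursions from `A` to the complement of `U`:
`N_{A,U} = sup {k ≥ 1 : D_k < ∞}` (with `sup ∅ = 0`). -/
noncomputable def Nexc (W : SRW d Ω) (A U : Set (Zd d)) (ω : Ω) : ℕ :=
  sSup {n | 0 < n ∧ W.Dt A U (n - 1) ω < ⊤}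

end SRW

end Disconnection

open Disconnection

namespace Aux11

def E (d : ℕ) : Type := BoundedContinuousFunction (Zd d) ℝ
noncomputable instance instE1 (d : ℕ) : NormedAddCommGroup (E d) :=
  inferInstanceAs (NormedAddCommGroup (BoundedContinuousFunction (Zd d) ℝ))
noncomputable instance instE2 (d : ℕ) : NormedSpace ℝ (E d) :=
  inferInstanceAs (NormedSpace ℝ (BoundedContinuousFunction (Zd d) ℝ))
noncomputable instance instE3 (d : ℕ) : CompleteSpace (E d) :=
  inferInstanceAs (CompleteSpace (BoundedContinuousFunction (Zd d) ℝ))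
instance instE4 (d : ℕ) : CoeFun (E d) (fun _ => Zd d → ℝ) :=
  ⟨fun f => DFunLike.coe (F := BoundedContinuousFunction (Zd d) ℝ) f⟩

abbrev Op (d : ℕ) := E d →L[ℝ] E d

theorem E.ext {d : ℕ} {f g : E d} (h : ∀ x, f x = g x) : f = g :=
  BoundedContinuousFunction.ext h

noncomputable def evC {d : ℕ} (y : Zd d) : E d →L[ℝ] ℝ :=
  BoundedContinuousFunction.evalCLM (α := Zd d) (β := ℝ) ℝ y

theorem evC_apply {d : ℕ} (y : Zd d) (f : E d) : evC y f = f y := rfl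
theorem E.add_apply {d : ℕ} (f g : E d) (y : Zd d) : (f + g) y = f y + g y := rfl
theorem E.sub_apply {d : ℕ} (f g : E d) (y : Zd d) : (f - g) y = f y - g y := rfl
theorem E.smul_apply {d : ℕ} (c : ℝ) (f : E d) (y : Zd d) : (c • f) y = c * f y := rfl

noncomputable def mkE {d : ℕ} (h : Zd d → ℝ) (C : ℝ) (hb : ∀ x, |h x| ≤ C) : E d :=
  BoundedContinuousFunction.ofNormedAddCommGroup h continuous_of_discreteTopology C hb

theorem mkE_apply {d : ℕ} (h : Zd d → ℝ) (C : ℝ) (hb : ∀ x, |h x| ≤ C) (x : Zd d) :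
    mkE h C hb x = h x := rfl

noncomputable def sh {d : ℕ} (v : Zd d) : Op d :=
  LinearMap.mkContinuous
    { toFun := fun f => BoundedContinuousFunction.compContinuous (α := Zd d) (β := ℝ) f
        ⟨fun y : Zd d => y + v, continuous_of_discreteTopology⟩
      map_add' := fun f g => rfl
      map_smul' := fun c f => rfl } 1 (by
        intro f
        rw [one_mul]
        refine (BoundedContinuousFunction.norm_le (norm_nonneg _)).2 fun x => ?_
        exact BoundedContinuousFunction.norm_coe_le_norm (α := Zd d) (β := ℝ) f _)

theorem sh_apply {d : ℕ} (v : Zd d) (h : E d) (y : Zd d) : sh v h y = h (y + v) := rfl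

theorem sh_mul {d : ℕ} (v w : Zd d) : sh v * sh w = sh (v + w) := by
  refine ContinuousLinearMap.ext fun h => E.ext fun y => ?_
  show h (y + v + w) = h (y + (v + w))
  rw [add_assoc]

theorem sh_zero {d : ℕ} : sh (0 : Zd d) = 1 := by
  refine ContinuousLinearMap.ext fun h => E.ext fun y => ?_
  show h (y + 0) = h y
  rw [add_zero]

theorem sh_comm {d : ℕ} (v w : Zd d) : Commute (sh v) (sh w) := by
  unfold Commute SemiconjBy
  rw [sh_mul, sh_mul, add_comm]

def ev {d : ℕ} (i : Fin d) : Zd d := Pi.single i 1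

noncomputable def Qi {d : ℕ} (i : Fin d) : Op d :=
  (1 / 4 : ℝ) • (sh (ev i) + (2 : ℝ) • 1 + sh (-ev i))

theorem Qi_apply {d : ℕ} (i : Fin d) (h : E d) (y : Zd d) :
    Qi i h y = (h (y + ev i) + 2 * h y + h (y + -ev i)) / 4 := by
  show (1 / 4 : ℝ) * (h (y + ev i) + 2 * h y + h (y + -ev i)) = _
  ring

theorem Qi_sh {d : ℕ} (i : Fin d) (v : Zd d) : Commute (Qi i) (sh v) := by
  unfold Qi
  refine Commute.smul_left ?_ _
  exact ((sh_comm _ _).add_left ((Commute.one_left _).smul_left _)).add_left (sh_comm _ _)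

theorem Qi_comm {d : ℕ} (i j : Fin d) : Commute (Qi i) (Qi j) := by
  rw [Qi.eq_def (i := j)]
  refine Commute.smul_right ?_ _
  exact ((Qi_sh _ _).add_right ((Commute.one_right _).smul_right _)).add_right (Qi_sh _ _)

noncomputable def Ti {d : ℕ} (i : Fin d) : Op d := (2 : ℝ) • (Qi i - 1)

theorem Ti_sh {d : ℕ} (i : Fin d) (v : Zd d) : Commute (Ti i) (sh v) :=
  ((Qi_sh i v).sub_left (Commute.one_left _)).smul_left _

theorem Ti_comm {d : ℕ} (i j : Fin d) : Commute (Ti i) (Ti j) :=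
  ((((Qi_comm i j).sub_left (Commute.one_left _)).smul_left _).sub_right
    (Commute.one_right _)).smul_right _

theorem exp_add' {d : ℕ} {x y : Op d} (h : Commute x y) :
    NormedSpace.exp (x + y) = NormedSpace.exp x * NormedSpace.exp y := by
  let _ : NormedAlgebra ℚ (Op d) := NormedAlgebra.restrictScalars ℚ ℝ (Op d)
  exact NormedSpace.exp_add_of_commute h

theorem exp_smul_one {d : ℕ} (c : ℝ) : NormedSpace.exp (c • (1 : Op d)) = Real.exp c • 1 := by
  have := NormedSpace.algebraMap_exp_comm (𝔸 := Op d) c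
  rw [Algebra.algebraMap_eq_smul_one, Algebra.algebraMap_eq_smul_one] at this
  rw [← this, Real.exp_eq_exp_ℝ]

noncomputable def Jop {d : ℕ} (s : ℝ) (i : Fin d) : Op d := NormedSpace.exp (s • Ti i)

theorem Jop_add {d : ℕ} (s t : ℝ) (i : Fin d) : Jop (s + t) i = Jop s i * Jop t i := by
  unfold Jop
  rw [add_smul]
  exact exp_add' (((Commute.refl _).smul_left _).smul_right _)

noncomputable def pois (a : ℝ) (m : ℕ) : ℝ := Real.exp (-a) * ((m.factorial : ℝ)⁻¹ * a ^ m)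

theorem pois_nonneg {a : ℝ} (ha : 0 ≤ a) (m : ℕ) : 0 ≤ pois a m := by
  unfold pois; positivity

theorem pois_hasSum (a : ℝ) : HasSum (pois a) 1 := by
  have h := NormedSpace.exp_series_hasSum_exp' (𝕂 := ℝ) (𝔸 := ℝ) a
  rw [← Real.exp_eq_exp_ℝ] at h
  have := h.mul_left (Real.exp (-a))
  rw [← Real.exp_add, neg_add_cancel, Real.exp_zero] at this
  exact this

theorem Jop_hasSum {d : ℕ} (s : ℝ) (i : Fin d) (h : E d) (y : Zd d) :
    HasSum (fun m => pois (2 * s) m * ((Qi i) ^ m) h y) (Jop s i h y) := by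
  have e1 : Jop s i = Real.exp (-(2 * s)) • NormedSpace.exp ((2 * s) • Qi i) := by
    unfold Jop Ti
    have : s • ((2 : ℝ) • (Qi i - 1)) = (2 * s) • Qi i + (-(2 * s)) • (1 : Op d) := by
      rw [smul_smul, smul_sub, neg_smul, ← sub_eq_add_neg, mul_comm]
    rw [this, exp_add' ((Commute.one_right _).smul_right _), exp_smul_one]
    rw [mul_smul_comm, mul_one]
  have h1 := NormedSpace.exp_series_hasSum_exp' (𝕂 := ℝ) ((2 * s) • Qi i : Op d)
  have h2 := (h1.const_smul (Real.exp (-(2 * s))))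
  rw [← e1] at h2
  have h3 := h2.mapL ((evC y).comp
    (ContinuousLinearMap.apply ℝ (E d) h))
  convert h3 using 2 with m
  · show _ = evC y (((Real.exp (-(2 * s))) • ((m.factorial : ℝ)⁻¹ • ((2 * s) • Qi i) ^ m) : Op d) h)
    rw [smul_pow]
    show _ = Real.exp (-(2 * s)) * ((m.factorial : ℝ)⁻¹ * ((2 * s) ^ m * ((Qi i) ^ m) h y))
    unfold pois
    ring
  · rfl

noncomputable def Kop {d : ℕ} (s : ℝ) : Op d := NormedSpace.exp (s • ∑ i, Ti (d := d) i)

theorem Kop_add {d : ℕ} (s t : ℝ) : Kop (d := d) (s + t) = Kop s * Kop t := by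
  unfold Kop
  rw [add_smul]
  exact exp_add' (((Commute.refl _).smul_left _).smul_right _)

theorem Kop_sh {d : ℕ} (s : ℝ) (v : Zd d) : Commute (Kop (d := d) s) (sh v) := by
  unfold Kop
  refine Commute.exp_left ?_
  exact (Commute.sum_left _ _ _ fun i _ => Ti_sh i v).smul_left _

theorem Kop_deriv {d : ℕ} (h : E d) (y : Zd d) (s : ℝ) :
    HasDerivAt (fun u => (Kop u h : E d) y) ((Kop s ((∑ i, Ti (d := d) i) h) : E d) y) s := by
  have h1 := hasDerivAt_exp_smul_const (𝕂 := ℝ) (∑ i, Ti (d := d) i) s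
  have h2 := ((evC y).comp (ContinuousLinearMap.apply ℝ (E d) h)).hasFDerivAt.comp_hasDerivAt s h1
  exact h2

end Aux11

namespace Aux11

theorem hasSum_cg {ι : Type*} {f g : ι → ℝ} {a b : ℝ} (h : HasSum f a) (hfg : ∀ n, g n = f n)
    (hab : b = a) : HasSum g b := by
  rw [hab, funext hfg]; exact h

noncomputable def bk : ℕ → ℤ → ℝ
  | 0 => fun n => if n = 0 then 1 else 0
  | m + 1 => fun n => (bk m (n - 1) + 2 * bk m n + bk m (n + 1)) / 4

theorem bk_succ (m : ℕ) (n : ℤ) : bk (m + 1) n = (bk m (n - 1) + 2 * bk m n + bk m (n + 1)) / 4 := rfl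

theorem bk_nonneg (m : ℕ) (n : ℤ) : 0 ≤ bk m n := by
  induction m generalizing n with
  | zero => simp only [bk]; split_ifs <;> norm_num
  | succ m ih => rw [bk_succ]; have := ih (n-1); have := ih n; have := ih (n+1); positivity

theorem bk_le_one (m : ℕ) (n : ℤ) : bk m n ≤ 1 := by
  induction m generalizing n with
  | zero => simp only [bk]; split_ifs <;> norm_num
  | succ m ih => rw [bk_succ]; have := ih (n-1); have := ih n; have := ih (n+1); linarith

theorem bk_symm (m : ℕ) (n : ℤ) : bk m (-n) = bk m n := by
  induction m generalizing n with
  | zero => simp only [bk, neg_eq_zero]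
  | succ m ih =>
    rw [bk_succ, bk_succ, show -n - 1 = -(n + 1) by ring, show -n + 1 = -(n - 1) by ring, ih, ih, ih]
    ring

theorem bk_mono (m : ℕ) (n : ℤ) (hn : 0 ≤ n) : bk m (n + 1) ≤ bk m n := by
  induction m generalizing n with
  | zero =>
    simp only [bk]
    rw [if_neg (by omega)]
    split_ifs <;> norm_num
  | succ m ih =>
    rw [bk_succ, bk_succ]
    rcases hn.eq_or_lt with h | h
    · subst h
      have h1 := ih 0 le_rfl
      have h2 := ih 1 (by norm_num)
      have h3 := bk_symm m 1
      norm_num at *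
      rw [h3]
      linarith
    · have h1 := ih (n - 1) (by omega)
      have h2 := ih n (by omega)
      have h3 := ih (n + 1) (by omega)
      rw [sub_add_cancel] at h1
      rw [add_sub_cancel_right]
      linarith

theorem bk_rec (m : ℕ) (n : ℤ) :
    (n : ℝ) * bk (m + 1) n = ((m : ℝ) + 1) / 4 * (bk m (n - 1) - bk m (n + 1)) := by
  induction m generalizing n with
  | zero =>
    rw [bk_succ]
    simp only [bk]
    by_cases h0 : n = 0
    · subst h0; norm_num
    by_cases h1 : n = 1
    · subst h1; norm_num
    by_cases h2 : n = -1
    · subst h2; norm_num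
    rw [if_neg h0, if_neg (by omega), if_neg (by omega)]
    norm_num
  | succ m ih =>
    have a := ih (n - 1)
    have b := ih n
    have c := ih (n + 1)
    have e1 : bk (m+1+1) n = _ := bk_succ (m + 1) n
    have e2 := bk_succ m (n - 1)
    have e3 := bk_succ m (n + 1)
    rw [e1]
    rw [sub_add_cancel] at a e2
    rw [add_sub_cancel_right] at c e3
    push_cast at *
    linear_combination (a + 2 * b + c)/4 + ((m : ℝ) + 1) / 4 * (e3 - e2)

theorem Qpow_hasSum {d : ℕ} (i : Fin d) (h : E d) (m : ℕ) (y : Zd d) :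
    HasSum (fun n : ℤ => bk m n * h (y + n • ev i)) ((Qi i ^ m) h y) := by
  induction m generalizing y with
  | zero =>
    have := hasSum_single (f := fun n : ℤ => bk 0 n * h (y + n • ev i)) 0 (by
      intro n hn
      simp only [bk, if_neg hn, zero_mul])
    simpa [bk] using this
  | succ m ih =>
    rw [pow_succ']
    show HasSum _ (Qi i ((Qi i ^ m) h) y)
    rw [Qi_apply]
    have h1 := (Equiv.hasSum_iff (Equiv.subRight (1 : ℤ))).2 (ih (y + ev i))
    have h2 := ih y
    have h3 := (Equiv.hasSum_iff (Equiv.addRight (1 : ℤ))).2 (ih (y + -ev i))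
    have h4 := (((h2.mul_left 2).add h1).add h3).div_const 4
    refine hasSum_cg h4 (fun n => ?_) ?_
    · rw [bk_succ]
      simp only [Function.comp, Equiv.subRight_apply, Equiv.coe_addRight]
      rw [show y + ev i + (n - 1) • ev i = y + n • ev i by rw [sub_smul, one_smul]; abel,
        show y + -ev i + (n + 1) • ev i = y + n • ev i by rw [add_smul, one_smul]; abel]
      ring
    · ring

noncomputable def qk (s : ℝ) (n : ℤ) : ℝ := ∑' m, pois (2 * s) m * bk m n

theorem qk_summable {s : ℝ} (hs : 0 ≤ s) (n : ℤ) : Summable (fun m => pois (2 * s) m * bk m n) := by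
  refine Summable.of_nonneg_of_le (fun m => mul_nonneg (pois_nonneg (by linarith) m) (bk_nonneg m n))
    (fun m => ?_) (pois_hasSum (2 * s)).summable
  exact mul_le_of_le_one_right (pois_nonneg (by linarith) m) (bk_le_one m n)

theorem qk_nonneg {s : ℝ} (hs : 0 ≤ s) (n : ℤ) : 0 ≤ qk s n :=
  tsum_nonneg fun m => mul_nonneg (pois_nonneg (by linarith) m) (bk_nonneg m n)

theorem qk_symm (s : ℝ) (n : ℤ) : qk s (-n) = qk s n := by
  unfold qk; simp only [bk_symm]

theorem qk_mono1 {s : ℝ} (hs : 0 ≤ s) (n : ℤ) (hn : 0 ≤ n) : qk s (n + 1) ≤ qk s n :=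
  (qk_summable hs _).tsum_le_tsum (fun m => mul_le_mul_of_nonneg_left (bk_mono m n hn)
    (pois_nonneg (by linarith) m)) (qk_summable hs _)

theorem qk_anti {s : ℝ} (hs : 0 ≤ s) {a b : ℤ} (ha : 0 ≤ a) (hab : a ≤ b) : qk s b ≤ qk s a := by
  obtain ⟨k, rfl⟩ := Int.le.dest hab
  clear hab
  induction k with
  | zero => simp
  | succ k ih =>
    push_cast
    rw [← add_assoc]
    exact (qk_mono1 hs _ (by omega)).trans ih

theorem qk_anti_abs {s : ℝ} (hs : 0 ≤ s) {a b : ℤ} (hab : |a| ≤ |b|) : qk s b ≤ qk s a := by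
  have h : ∀ a : ℤ, qk s a = qk s |a| := by
    intro a
    rcases abs_choice a with h | h <;> rw [h]
    rw [qk_symm]
  rw [h a, h b]
  exact qk_anti hs (abs_nonneg _) hab

theorem qk_rec {s : ℝ} (hs : 0 ≤ s) (n : ℤ) :
    (n : ℝ) * qk s n = s / 2 * (qk s (n - 1) - qk s (n + 1)) := by
  have h1 : HasSum (fun m => s / 2 * (pois (2 * s) m * bk m (n - 1) - pois (2 * s) m * bk m (n + 1)))
      (s / 2 * (qk s (n - 1) - qk s (n + 1))) :=
    (((qk_summable hs _).hasSum).sub ((qk_summable hs _).hasSum)).mul_left _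
  have h2 : HasSum (fun m => (n : ℝ) * (pois (2 * s) m * bk m n)) ((n : ℝ) * qk s n) :=
    ((qk_summable hs _).hasSum).mul_left _
  rw [← hasSum_nat_add_iff' 1] at h2
  have h3 : (∑ i ∈ Finset.range 1, (n : ℝ) * (pois (2 * s) i * bk i n)) = 0 := by
    simp only [Finset.range_one, Finset.sum_singleton, bk]
    split_ifs with h
    · subst h; simp
    · simp
  rw [h3, sub_zero] at h2
  refine h2.unique ?_
  refine hasSum_cg h1 (fun m => ?_) rfl
  have : pois (2 * s) (m + 1) * ((m : ℝ) + 1) = pois (2 * s) m * (2 * s) := by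
    unfold pois
    rw [Nat.factorial_succ]
    push_cast
    field_simp
    ring
  have h4 := bk_rec m n
  linear_combination pois (2 * s) (m + 1) * h4 + (bk m (n-1) - bk m (n+1))/4 * this

theorem J_hasSum {d : ℕ} {s : ℝ} (hs : 0 ≤ s) (i : Fin d) (h : E d) (hh : ∀ y, 0 ≤ h y) (y : Zd d) :
    HasSum (fun n : ℤ => qk s n * h (y + n • ev i)) (Jop s i h y) := by
  have hJ := Jop_hasSum s i h y
  let f : ℕ × ℤ → ℝ := fun p => pois (2 * s) p.1 * (bk p.1 p.2 * h (y + p.2 • ev i))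
  have hf0 : ∀ p, 0 ≤ f p := fun p =>
    mul_nonneg (pois_nonneg (by linarith) _) (mul_nonneg (bk_nonneg _ _) (hh _))
  have hfib : ∀ m, HasSum (fun n => f (m, n)) (pois (2 * s) m * (Qi i ^ m) h y) := fun m =>
    (Qpow_hasSum i h m y).mul_left _
  have hsum : Summable f := by
    rw [summable_prod_of_nonneg hf0]
    refine ⟨fun m => (hfib m).summable, ?_⟩
    convert hJ.summable using 2 with m
    exact (hfib m).tsum_eq
  have h1 : HasSum f (Jop s i h y) := by
    have h2 := hsum.hasSum.prod_fiberwise hfib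
    rw [hJ.unique h2]
    exact hsum.hasSum
  have h3 := (Equiv.hasSum_iff (Equiv.prodComm ℤ ℕ)).2 h1
  refine h3.prod_fiberwise fun n => ?_
  refine hasSum_cg ((qk_summable hs n).hasSum.mul_right (h (y + n • ev i))) (fun m => ?_) rfl
  show pois (2 * s) m * (bk m n * h (y + n • ev i)) = _
  ring

theorem J_nonneg {d : ℕ} {s : ℝ} (hs : 0 ≤ s) (i : Fin d) (h : E d) (hh : ∀ y, 0 ≤ h y) (y : Zd d) :
    0 ≤ Jop s i h y :=
  (J_hasSum hs i h hh y).nonneg fun n => mul_nonneg (qk_nonneg hs n) (hh _)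

noncomputable def oneE (d : ℕ) : E d := mkE (fun _ => 1) 1 (by simp)

theorem Ti_one {d : ℕ} (i : Fin d) : Ti i (oneE d) = 0 := by
  refine E.ext fun y => ?_
  show (2 : ℝ) * ((Qi i (oneE d) : E d) y - oneE d y) = 0
  rw [Qi_apply]
  simp only [oneE, mkE_apply]
  norm_num

theorem exp_apply_of_zero {d : ℕ} (A : Op d) (h : E d) (hA : A h = 0) :
    NormedSpace.exp A h = h := by
  have h1 := NormedSpace.exp_series_hasSum_exp' (𝕂 := ℝ) A
  have h2 := h1.mapL (ContinuousLinearMap.apply ℝ (E d) h)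
  have h3 := hasSum_single (f := fun n => (ContinuousLinearMap.apply ℝ (E d) h) ((n.factorial : ℝ)⁻¹ • A ^ n)) 0 (by
    intro n hn
    obtain ⟨k, rfl⟩ := Nat.exists_eq_succ_of_ne_zero hn
    show (((k+1).factorial : ℝ)⁻¹ • (A ^ (k + 1)) : Op d) h = 0
    rw [pow_succ]
    show ((k+1).factorial : ℝ)⁻¹ • (A ^ k) (A h) = 0
    rw [hA]; simp)
  have := h2.unique h3
  simpa using this

theorem qk_hasSum {s : ℝ} (hs : 0 ≤ s) : HasSum (qk s) 1 := by
  have h := J_hasSum hs (0 : Fin 1) (oneE 1) (fun y => by simp [oneE, mkE_apply]) 0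
  unfold Jop at h
  rw [exp_apply_of_zero _ _ (by rw [_root_.smul_apply, Ti_one, smul_zero])] at h
  simpa [oneE, mkE_apply] using h

noncomputable def dl {d : ℕ} (w : Zd d) : E d := mkE (fun y => if y = w then 1 else 0) 1 (by
  intro x; split_ifs <;> simp)

theorem dl_apply {d : ℕ} (w y : Zd d) : dl w y = if y = w then 1 else 0 := rfl

theorem dl_nonneg {d : ℕ} (w y : Zd d) : 0 ≤ dl w y := by
  rw [dl_apply]; split_ifs <;> norm_num

theorem J1_dl {s : ℝ} (hs : 0 ≤ s) (w y : Zd 1) : Jop s 0 (dl w) y = qk s (w 0 - y 0) := by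
  have h := J_hasSum hs (0 : Fin 1) (dl w) (dl_nonneg w) y
  refine h.unique ?_
  have h2 := hasSum_single (f := fun n : ℤ => qk s n * dl w (y + n • ev 0)) (w 0 - y 0) (by
    intro n hn
    rw [dl_apply, if_neg, mul_zero]
    intro h
    apply hn
    have := congrFun h 0
    simp [ev] at this
    omega)
  convert h2 using 1
  rw [dl_apply, if_pos, mul_one]
  funext j
  fin_cases j
  simp [ev]

theorem qk_conv {s t : ℝ} (hs : 0 ≤ s) (ht : 0 ≤ t) (n : ℤ) (F : Finset ℤ) :
    ∑ j ∈ F, qk s j * qk t (n - j) ≤ qk (s + t) n := by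
  have h0 : ∀ y, 0 ≤ Jop t (0 : Fin 1) (dl (fun _ => n)) y := J_nonneg ht _ _ (dl_nonneg _)
  have h := J_hasSum hs (0 : Fin 1) (Jop t 0 (dl (fun _ => n))) h0 0
  have e1 : Jop s (0 : Fin 1) (Jop t 0 (dl (fun _ => n))) (0 : Zd 1) = qk (s + t) n := by
    show (Jop s (0 : Fin 1) * Jop t 0 : Op 1) (dl (fun _ => n)) (0 : Zd 1) = qk (s + t) n
    rw [← Jop_add, J1_dl (by linarith)]
    simp
  rw [e1] at h
  have h3 := sum_le_hasSum F (fun j _ => mul_nonneg (qk_nonneg hs j) (h0 _)) h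
  refine le_trans (le_of_eq (Finset.sum_congr rfl fun j _ => ?_)) h3
  rw [J1_dl ht]
  simp [ev]

end Aux11

namespace Aux11

theorem qk_diff {s : ℝ} (hs : 0 < s) (n : ℤ) :
    qk s (n - 1) - qk s (n + 1) = 2 * n / s * qk s n := by
  have := qk_rec hs.le n
  field_simp
  linarith

theorem qk_le_zero {s : ℝ} (hs : 0 ≤ s) (n : ℤ) : qk s n ≤ qk s 0 :=
  qk_anti_abs hs (by simp)

theorem qk_upper {s : ℝ} (hs : 0 < s) (n : ℤ) : qk s n ≤ 4 / √s := by
  refine (qk_le_zero hs.le n).trans ?_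
  have hq0 := qk_nonneg hs.le 0
  have h1 : ∀ i : ℕ, qk s 0 * (1 - 2 * (i : ℝ) ^ 2 / s) ≤ qk s (2 * i : ℕ) := by
    intro i
    induction i with
    | zero => simp
    | succ i ih =>
      have h := qk_diff hs (2 * i + 1)
      have h2 := qk_le_zero hs.le (2 * i + 1)
      rw [add_sub_cancel_right, show (2 * (i : ℤ) + 1 + 1) = ((2 * (i + 1) : ℕ) : ℤ) by push_cast; ring,
        show (2 * (i : ℤ)) = ((2 * i : ℕ) : ℤ) by push_cast; ring] at h
      have h3 : 2 * (((2 * i : ℕ) : ℤ) + 1 : ℤ) / s * qk s (((2 * i : ℕ) : ℤ) + 1) ≤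
          2 * (2 * (i : ℝ) + 1) / s * qk s 0 := by
        push_cast
        gcongr
      have h4 : qk s 0 * (1 - 2 * ((i + 1 : ℕ) : ℝ) ^ 2 / s) =
          qk s 0 * (1 - 2 * (i : ℝ) ^ 2 / s) - 2 * (2 * (i : ℝ) + 1) / s * qk s 0 := by
        push_cast
        field_simp
        ring
      linarith
  set r : ℕ := ⌊√s / 2⌋₊ with hr
  have hr1 : (r : ℝ) ≤ √s / 2 := Nat.floor_le (by positivity)
  have hr2 : √s / 2 < r + 1 := Nat.lt_floor_add_one _
  have hss : √s ^ 2 = s := Real.sq_sqrt hs.le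
  have hsp : 0 < √s := Real.sqrt_pos.2 hs
  have h2 := sum_le_hasSum ((Finset.range (r + 1)).map ⟨fun i : ℕ => ((2 * i : ℕ) : ℤ), fun a b h => by
    simp at h; omega⟩) (fun j _ => qk_nonneg hs.le j) (qk_hasSum hs.le)
  rw [Finset.sum_map] at h2
  have h3 : ∑ i ∈ Finset.range (r + 1), qk s 0 / 2 ≤ 1 := by
    refine le_trans (Finset.sum_le_sum fun i hi => ?_) h2
    refine le_trans ?_ (h1 i)
    have hi' : (i : ℝ) ≤ √s / 2 := le_trans (by
      exact_mod_cast Nat.lt_succ_iff.1 (Finset.mem_range.1 hi)) hr1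
    have : 2 * (i : ℝ) ^ 2 / s ≤ 1 / 2 := by
      rw [div_le_iff₀ hs]
      nlinarith [Nat.cast_nonneg (α := ℝ) i]
    nlinarith
  rw [Finset.sum_const, Finset.card_range, nsmul_eq_mul] at h3
  push_cast at h3
  rw [le_div_iff₀ hsp]
  nlinarith

theorem qk_zero_lower {s : ℝ} (hs : 1 ≤ s) : 1 / (5 * √s) ≤ qk s 0 := by
  have hs0 : 0 < s := by linarith
  have hq0 := qk_nonneg hs0.le 0
  have hss : √s ^ 2 = s := Real.sq_sqrt hs0.le
  have hsp : 0 < √s := Real.sqrt_pos.2 hs0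
  have hs1 : 1 ≤ √s := Real.one_le_sqrt.2 hs
  set r : ℕ := ⌈√s⌉₊ with hr
  have hr1 : √s ≤ r := Nat.le_ceil _
  have hr2 : (r : ℝ) < √s + 1 := Nat.ceil_lt_add_one hsp.le
  have h1 : ∀ N : ℕ, ∑ n ∈ Finset.range N, qk s ((r : ℤ) + n) ≤
      √s / 2 * (qk s (r - 1) + qk s r - qk s ((r : ℤ) + N - 1) - qk s ((r : ℤ) + N)) := by
    intro N
    induction N with
    | zero => simp
    | succ N ih =>
      rw [Finset.sum_range_succ]
      have h := qk_rec hs0.le ((r : ℤ) + N)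
      have hq := qk_nonneg hs0.le ((r : ℤ) + N)
      push_cast at h ⊢
      rw [show (r : ℤ) + (N + 1) - 1 = r + N by ring, show (r : ℤ) + (N + 1) = r + N + 1 by ring]
      have h3 : √s * qk s (r + N) ≤ √s * (√s / 2 * (qk s ((r : ℤ) + N - 1) - qk s (r + N + 1))) := by
        rw [← mul_assoc, show √s * (√s / 2) = s / 2 by rw [← hss]; ring_nf; simp, ← h]
        gcongr
        linarith [Nat.cast_nonneg (α := ℝ) N]
      have h4 := le_of_mul_le_mul_left h3 hsp
      linarith
  have h2 : ∀ N : ℕ, ∑ n ∈ Finset.range N, (qk s (n : ℤ) + qk s (-(n : ℤ))) ≤ 2 * (r + √s) * qk s 0 := by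
    intro N
    simp only [qk_symm, ← two_mul]
    rw [← Finset.mul_sum, mul_assoc]
    gcongr
    calc ∑ n ∈ Finset.range N, qk s (n : ℤ) ≤ ∑ n ∈ Finset.range (r + N), qk s (n : ℤ) :=
          Finset.sum_le_sum_of_subset_of_nonneg (Finset.range_mono (by omega))
            fun _ _ _ => qk_nonneg hs0.le _
      _ = ∑ n ∈ Finset.range r, qk s (n : ℤ) + ∑ n ∈ Finset.range N, qk s ((r : ℤ) + n) := by
          rw [Finset.sum_range_add]; push_cast; rfl
      _ ≤ ∑ n ∈ Finset.range r, qk s 0 + √s / 2 * (qk s 0 + qk s 0) := by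
          refine add_le_add (Finset.sum_le_sum fun n _ => qk_le_zero hs0.le _) ((h1 N).trans ?_)
          gcongr
          have := qk_nonneg hs0.le ((r : ℤ) + N - 1)
          have := qk_nonneg hs0.le ((r : ℤ) + N)
          have := qk_le_zero hs0.le ((r : ℤ) - 1)
          have := qk_le_zero hs0.le (r : ℤ)
          linarith
      _ = (r + √s) * qk s 0 := by
          rw [Finset.sum_const, Finset.card_range, nsmul_eq_mul]; ring
  have h3 := (qk_hasSum hs0.le).nat_add_neg
  have h4 := le_of_tendsto' h3.tendsto_sum_nat h2
  rw [div_le_iff₀ (by positivity)]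
  nlinarith

theorem qk_lower (A : ℝ) (hA : 1 ≤ A) : ∃ c > 0, ∃ s0 ≥ 1, ∀ s ≥ s0, ∀ n : ℤ, |(n : ℝ)| ≤ A * √s →
    c / √s ≤ qk s n := by
  refine ⟨Real.exp (-(4 * A ^ 2)) / 5, by positivity, 16 * A ^ 2, by nlinarith, ?_⟩
  intro s hs n hn
  have hs1 : 1 ≤ s := by nlinarith
  have hs0 : 0 < s := by linarith
  have hss : √s ^ 2 = s := Real.sq_sqrt hs0.le
  have hsp : 0 < √s := Real.sqrt_pos.2 hs0
  have hs1' : 1 ≤ √s := Real.one_le_sqrt.2 hs1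
  have hA4 : 4 * A ≤ √s := Real.le_sqrt_of_sq_le (by nlinarith)
  set x := 2 * A / √s with hx
  have hx0 : 0 ≤ x := by positivity
  have hx1 : x ≤ 1 / 2 := by rw [hx, div_le_iff₀ hsp]; linarith
  have key : ∀ i : ℕ, (2 * (i : ℝ) - 1 ≤ A * √s) → (1 - x) ^ i * qk s 0 ≤ qk s (2 * i : ℕ) := by
    intro i
    induction i with
    | zero => simp
    | succ i ih =>
      intro hi
      push_cast at hi
      have ih := ih (by linarith)
      have h := qk_diff hs0 (2 * i + 1)
      have h2 := qk_mono1 hs0.le (2 * i) (by positivity)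
      rw [add_sub_cancel_right, show (2 * (i : ℤ) + 1 + 1) = ((2 * (i + 1) : ℕ) : ℤ) by push_cast; ring,
        show (2 * (i : ℤ)) = ((2 * i : ℕ) : ℤ) by push_cast; ring] at h
      have h3 : 2 * (((2 * i : ℕ) : ℤ) + 1 : ℤ) / s * qk s (((2 * i : ℕ) : ℤ) + 1) ≤
          x * qk s (2 * i : ℕ) := by
        have hq := qk_nonneg hs0.le (((2 * i : ℕ) : ℤ) + 1)
        refine mul_le_mul ?_ (by push_cast; exact h2) hq hx0
        rw [hx, div_le_div_iff₀ hs0 hsp]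
        push_cast
        nlinarith
      rw [pow_succ]
      have h5 : (1 - x) * ((1 - x) ^ i * qk s 0) ≤ (1 - x) * qk s (2 * i : ℕ) :=
        mul_le_mul_of_nonneg_left ih (by linarith)
      nlinarith
  obtain ⟨i, hi1, hi2⟩ : ∃ i : ℕ, n.natAbs ≤ 2 * i ∧ 2 * i ≤ n.natAbs + 1 :=
    ⟨(n.natAbs + 1) / 2, by omega, by omega⟩
  have hn' : (n.natAbs : ℝ) ≤ A * √s := by rw [Nat.cast_natAbs]; push_cast; exact hn
  have hi2' : 2 * (i : ℝ) ≤ n.natAbs + 1 := by exact_mod_cast hi2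
  have hk := key i (by linarith)
  have h6 : qk s (2 * i : ℕ) ≤ qk s n := qk_anti_abs hs0.le (by
    rw [Int.abs_eq_natAbs, Int.abs_eq_natAbs]; omega)
  refine le_trans ?_ (hk.trans h6)
  have h7 : Real.exp (-(2 * x)) ≤ 1 - x := by
    rw [Real.exp_neg, inv_le_comm₀ (Real.exp_pos _) (by linarith)]
    refine le_trans ?_ (Real.add_one_le_exp _)
    rw [inv_le_iff_one_le_mul₀ (by linarith)]
    nlinarith
  have h8 : Real.exp (-(4 * A ^ 2)) ≤ (1 - x) ^ i := by
    refine le_trans ?_ (pow_le_pow_left₀ (Real.exp_pos _).le h7 i)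
    rw [← Real.exp_nat_mul]
    refine Real.exp_le_exp.2 ?_
    have : x * √s = 2 * A := by rw [hx]; field_simp
    have hi3 : (i : ℝ) ≤ A * √s := by nlinarith
    nlinarith
  have h9 := qk_zero_lower hs1
  have h10 : 0 ≤ (1 - x) ^ i := pow_nonneg (by linarith) _
  calc Real.exp (-(4 * A ^ 2)) / 5 / √s = Real.exp (-(4 * A ^ 2)) * (1 / (5 * √s)) := by
        field_simp
    _ ≤ _ := by gcongr

theorem qk_back {s y : ℝ} (hs : 0 < s) (hy : 0 ≤ y) (n : ℤ) (i : ℕ) (h : y * s ≤ 2 * ((n : ℝ) - 2 * i))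
    (hn : 0 ≤ n - 2 * i) :
    (1 + y) ^ i * qk s n ≤ qk s (n - 2 * i) := by
  induction i with
  | zero => simp
  | succ i ih =>
    push_cast at h hn ⊢
    have ih := ih (by linarith) (by linarith)
    have h1 := qk_diff hs (n - 2 * i - 1)
    have h2 := qk_mono1 hs.le (n - 2 * i - 1) (by linarith)
    rw [sub_add_cancel] at h1 h2
    have h3 : y * qk s (n - 2 * i) ≤ 2 * (n - 2 * i - 1 : ℤ) / s * qk s (n - 2 * i - 1) := by
      refine mul_le_mul ?_ h2 (qk_nonneg hs.le _) ?_
      · rw [le_div_iff₀ hs]; push_cast; linarith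
      · have : (0 : ℝ) ≤ (n - 2 * i - 1 : ℤ) := by 
          have h' : (0 : ℤ) ≤ n - 2 * i - 1 := by linarith
          exact_mod_cast h'
        positivity
    rw [show n - 2 * ((i : ℤ) + 1) = n - 2 * i - 1 - 1 by ring, pow_succ]
    nlinarith

theorem qk_L1 (k : ℕ) (hk : 1 ≤ k) : ∃ c > 0, ∃ s0 ≥ 1, ∀ s t : ℝ, 0 < s → s ≤ t → s0 ≤ t → ∀ n : ℤ,
    √t ≤ n → c * (√t * n / s) ^ k * qk s n ≤ qk (2 * t) n := by
  obtain ⟨c, hc, s0, hs01, H⟩ := qk_lower 1 le_rfl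
  refine ⟨c / 16 * (1 / (32 * k)) ^ k, by positivity, s0 + (32 * k) ^ 2, by
    have : (0 : ℝ) ≤ (32 * k) ^ 2 := by positivity
    linarith, ?_⟩
  intro s t hs hst ht n hn
  have hk' : (1 : ℝ) ≤ k := by exact_mod_cast hk
  have ht0 : 0 < t := by linarith
  have hss : √t ^ 2 = t := Real.sq_sqrt ht0.le
  have htp : 0 < √t := Real.sqrt_pos.2 ht0
  have htk : 32 * (k : ℝ) ≤ √t := Real.le_sqrt_of_sq_le (by linarith)
  have hn0 : (0 : ℝ) < n := by linarith
  set a : ℕ := ⌊√t / 8⌋₊ with ha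
  have ha1 : (a : ℝ) ≤ √t / 8 := Nat.floor_le (by positivity)
  have ha2 : √t / 8 < a + 1 := Nat.lt_floor_add_one _
  set y : ℝ := n / s with hy
  have hy0 : 0 < y := by positivity
  have hb : ∀ i ∈ Finset.Icc a (2 * a), c / (2 * √t) * ((√t / (32 * k) * y) ^ k * qk s n) ≤
      qk (2 * t - s) (2 * i : ℕ) * qk s (n - (2 * i : ℕ)) := by
    intro i hi
    rw [Finset.mem_Icc] at hi
    have hi1 : (a : ℝ) ≤ i := by exact_mod_cast hi.1
    have hi2 : (i : ℝ) ≤ 2 * a := by exact_mod_cast hi.2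
    have hsq : √(2 * t - s) ≤ 2 * √t := by
      rw [Real.sqrt_le_left (by positivity)]
      nlinarith
    have hsq2 : √t ≤ √(2 * t - s) := Real.sqrt_le_sqrt (by linarith)
    have h1 : c / (2 * √t) ≤ qk (2 * t - s) (2 * i : ℕ) := by
      refine le_trans ?_ (H _ ?_ _ ?_)
      · gcongr
        linarith
      · have : (0 : ℝ) ≤ (32 * k) ^ 2 := by positivity
        linarith
      · push_cast
        rw [abs_of_nonneg (by positivity)]
        linarith
    have hni : (n : ℝ) / 2 ≤ n - 2 * i := by linarith
    have h2 : (1 + y) ^ i * qk s n ≤ qk s (n - 2 * i) := by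
      refine qk_back hs hy0.le n i ?_ ?_
      · rw [hy, div_mul_cancel₀ _ hs.ne']; linarith
      · have : (0 : ℝ) ≤ ((n - 2 * i : ℤ) : ℝ) := by push_cast; linarith
        exact_mod_cast this
    have h3 : (√t / (32 * k) * y) ^ k ≤ (1 + y) ^ i := by
      have hdm : k * (i / k) ≤ i := Nat.mul_div_le i k
      have hdm2 : i < k * (i / k) + k := by
        have := Nat.lt_mul_div_succ i (show 0 < k by omega)
        rw [mul_add, mul_one] at this
        exact this
      have hdm3 : (i : ℝ) < k * ((i / k : ℕ) : ℝ) + k := by exact_mod_cast hdm2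
      have hq : √t / (32 * k) ≤ ((i / k : ℕ) : ℝ) := by
        rw [div_le_iff₀ (by positivity)]
        nlinarith
      calc (√t / (32 * k) * y) ^ k ≤ ((1 + y) ^ (i / k)) ^ k := by
            gcongr
            refine le_trans ?_ (one_add_mul_le_pow (by linarith) (i / k))
            nlinarith
        _ = (1 + y) ^ (k * (i / k)) := by rw [← pow_mul, mul_comm]
        _ ≤ (1 + y) ^ i := pow_le_pow_right₀ (by linarith) hdm
    have hq := qk_nonneg hs.le n
    have h4 : (√t / (32 * k) * y) ^ k * qk s n ≤ qk s (n - (2 * i : ℕ)) := by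
      push_cast
      exact le_trans (mul_le_mul_of_nonneg_right h3 hq) h2
    exact mul_le_mul h1 h4 (by positivity) (qk_nonneg (by linarith) _)
  have h5 := qk_conv (s := 2 * t - s) (t := s) (by linarith) hs.le n
    ((Finset.Icc a (2 * a)).map ⟨fun i : ℕ => ((2 * i : ℕ) : ℤ), fun a b h => by
    simp at h; omega⟩)
  rw [Finset.sum_map, sub_add_cancel] at h5
  have h6 := (Finset.sum_le_sum hb).trans h5
  refine le_trans ?_ h6
  rw [Finset.sum_const, Nat.card_Icc, nsmul_eq_mul]
  have h7 : √t / 8 ≤ ((2 * a + 1 - a : ℕ) : ℝ) := by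
    rw [show 2 * a + 1 - a = a + 1 by omega]; push_cast; exact ha2.le
  have hq := qk_nonneg hs.le n
  calc c / 16 * (1 / (32 * k)) ^ k * (√t * n / s) ^ k * qk s n
      = (√t / 8) * (c / (2 * √t) * ((√t / (32 * k) * y) ^ k * qk s n)) := by
        have : (√t / (32 * k) * y) ^ k = (1 / (32 * k)) ^ k * (√t * n / s) ^ k := by
          rw [← mul_pow]; congr 1; rw [hy]; field_simp
        rw [this]
        field_simp
        ring
    _ ≤ _ := by gcongr

theorem qk_Cmp : ∃ C > 0, ∃ s0 ≥ 1, ∀ s t : ℝ, 0 < s → s ≤ t → s0 ≤ t → ∀ n k : ℤ,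
    |(k : ℝ)| ≤ √t → qk s n ≤ C * √(t / s) * qk (2 * t) (n + k) := by
  obtain ⟨c, hc, s0, hs01, H⟩ := qk_lower 2 (by norm_num)
  refine ⟨16 / c, by positivity, s0 , hs01, ?_⟩
  intro s t hs hst ht
  have ht0 : 0 < t := by linarith
  have hss : √t ^ 2 = t := Real.sq_sqrt ht0.le
  have htp : 0 < √t := Real.sqrt_pos.2 ht0
  have hts : √(t / s) = √t / √s := Real.sqrt_div ht0.le s
  have hsp : 0 < √s := Real.sqrt_pos.2 hs
  have hts1 : 1 ≤ √(t / s) := Real.one_le_sqrt.2 (by rw [le_div_iff₀ hs]; linarith)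
  have main : ∀ n k : ℤ, 0 ≤ n → |(k : ℝ)| ≤ √t → qk s n ≤ 16 / c * √(t / s) * qk (2 * t) (n + k) := by
    intro n k hn hk
    have hn' : (0 : ℝ) ≤ n := by exact_mod_cast hn
    have hk1 := neg_le_of_abs_le hk
    have hk2 := le_of_abs_le hk
    have hq := qk_nonneg hs.le n
    have hq2 := qk_nonneg (show 0 ≤ 2 * t by linarith) (n + k)
    by_cases hcase : √t / 2 ≤ n
    · set a : ℕ := ⌊√t / 2⌋₊ with ha
      have ha1 : (a : ℝ) ≤ √t / 2 := Nat.floor_le (by positivity)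
      have ha2 : √t / 2 < a + 1 := Nat.lt_floor_add_one _
      have h5 := qk_conv (s := 2 * t - s) (t := s) (by linarith) hs.le (n + k)
        ((Finset.range (a + 1)).map ⟨fun i : ℕ => k + i, fun a b h => by
        simp at h; omega⟩)
      rw [Finset.sum_map, sub_add_cancel] at h5
      have hb : ∀ i ∈ Finset.range (a + 1), c / (2 * √t) * qk s n ≤
          qk (2 * t - s) (k + i) * qk s (n + k - (k + i)) := by
        intro i hi
        have hi' : (i : ℝ) ≤ a := by exact_mod_cast Nat.lt_succ_iff.1 (Finset.mem_range.1 hi)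
        have hsq : √(2 * t - s) ≤ 2 * √t := by
          rw [Real.sqrt_le_left (by positivity)]
          nlinarith
        have hsq2 : √t ≤ √(2 * t - s) := Real.sqrt_le_sqrt (by linarith)
        have h1 : c / (2 * √t) ≤ qk (2 * t - s) (k + i) := by
          refine le_trans ?_ (H _ (by linarith) _ ?_)
          · gcongr
            linarith
          · push_cast
            rw [abs_le]
            constructor <;> linarith [Nat.cast_nonneg (α := ℝ) i]
        have h2 : qk s n ≤ qk s (n + k - (k + i)) := by
          have : (i : ℝ) ≤ n := by linarith
          have : (i : ℤ) ≤ n := by exact_mod_cast this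
          exact qk_anti hs.le (by omega) (by omega)
        exact mul_le_mul h1 h2 hq (qk_nonneg (by linarith) _)
      have h6 := (Finset.sum_le_sum hb).trans h5
      rw [Finset.sum_const, Finset.card_range, nsmul_eq_mul] at h6
      have h7 : c / 4 * qk s n ≤ qk (2 * t) (n + k) := by
        refine le_trans ?_ h6
        calc c / 4 * qk s n = √t / 2 * (c / (2 * √t) * qk s n) := by field_simp; ring
          _ ≤ _ := by gcongr; push_cast; exact ha2.le
      calc qk s n = 4 / c * (c / 4 * qk s n) := by field_simp
        _ ≤ 4 / c * qk (2 * t) (n + k) := by gcongr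
        _ ≤ 16 / c * √(t / s) * qk (2 * t) (n + k) := by
          gcongr
          rw [div_mul_eq_mul_div, div_le_div_iff_of_pos_right hc]
          linarith
    · push Not at hcase
      have h1 := qk_upper hs n
      have hsq2 : √t ≤ √(2 * t) := Real.sqrt_le_sqrt (by linarith)
      have hsq : √(2 * t) ≤ 2 * √t := by
        rw [Real.sqrt_le_left (by positivity)]
        nlinarith
      have h2 : c / (2 * √t) ≤ qk (2 * t) (n + k) := by
        refine le_trans ?_ (H _ (by linarith) _ ?_)
        · gcongr
        · push_cast
          rw [abs_le]
          constructor <;> linarith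
      calc qk s n ≤ 4 / √s := h1
        _ = 8 / c * √(t / s) * (c / (2 * √t)) := by rw [hts]; field_simp; norm_num
        _ ≤ 16 / c * √(t / s) * qk (2 * t) (n + k) := by gcongr; norm_num
  intro n k hk
  rcases le_total 0 n with h | h
  · exact main n k h hk
  · have := main (-n) (-k) (by omega) (by push_cast; rwa [abs_neg])
    rwa [qk_symm, ← neg_add, qk_symm] at this

theorem qk_Grad : ∃ C > 0, ∃ s0 ≥ 1, ∀ s : ℝ, s0 ≤ s → ∀ n : ℤ,
    |qk s n - qk s (n + 1)| ≤ C / √s * qk (2 * s) n := by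
  obtain ⟨c, hc, s0, hs01, H⟩ := qk_L1 1 le_rfl
  obtain ⟨C, hC, s1, hs11, H1⟩ := qk_Cmp
  refine ⟨2 * (C + 1 / c), by positivity, s0 + s1, by linarith, ?_⟩
  intro s hs
  have hs0 : 0 < s := by linarith
  have hss : √s ^ 2 = s := Real.sq_sqrt hs0.le
  have hsp : 0 < √s := Real.sqrt_pos.2 hs0
  have G : ∀ n : ℤ, 0 ≤ n → 2 * n / s * qk s n ≤ 2 * (C + 1 / c) / √s * qk (2 * s) n := by
    intro n hn
    have hn' : (0 : ℝ) ≤ n := by exact_mod_cast hn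
    have hq := qk_nonneg hs0.le n
    have hq2 := qk_nonneg (show 0 ≤ 2 * s by linarith) n
    by_cases hcase : √s ≤ n
    · have h := H s s hs0 le_rfl (by linarith) n hcase
      rw [pow_one] at h
      calc 2 * n / s * qk s n = 2 * (1 / c) / √s * (c * (√s * n / s) * qk s n) := by field_simp
        _ ≤ 2 * (1 / c) / √s * qk (2 * s) n := by gcongr
        _ ≤ _ := by gcongr; linarith
    · push Not at hcase
      have h := H1 s s hs0 le_rfl (by linarith) n 0 (by simp)
      rw [div_self hs0.ne', Real.sqrt_one, add_zero, mul_one] at h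
      calc 2 * n / s * qk s n ≤ 2 * √s / s * (C * qk (2 * s) n) := by gcongr
        _ = 2 * C / √s * qk (2 * s) n := by
          nth_rw 2 [← hss]; field_simp
        _ ≤ _ := by
          have : 0 < 1 / c := by positivity
          gcongr; linarith
  have G2 : ∀ n : ℤ, 0 ≤ n → |qk s n - qk s (n + 1)| ≤ 2 * (C + 1 / c) / √s * qk (2 * s) (n + 1) := by
    intro n hn
    have h1 := qk_mono1 hs0.le n hn
    have h2 := qk_mono1 hs0.le (n + 1) (by omega)
    have h3 := qk_diff hs0 (n + 1)
    rw [add_sub_cancel_right] at h3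
    rw [abs_of_nonneg (by linarith)]
    refine le_trans ?_ (G (n + 1) (by omega))
    linarith
  intro n
  rcases le_or_gt 0 n with h | h
  · refine (G2 n h).trans ?_
    gcongr
    exact qk_mono1 (by linarith) n h
  · have := G2 (-n - 1) (by omega)
    rw [sub_add_cancel, qk_symm, qk_symm, show -n - 1 = -(n + 1) by ring, qk_symm, abs_sub_comm] at this
    exact this

end Aux11

namespace Aux11

variable {d : ℕ}

noncomputable def KF (F : Finset (Fin d)) (s : ℝ) : Op d := NormedSpace.exp (s • ∑ i ∈ F, Ti (d := d) i)

theorem KF_univ (s : ℝ) : KF (d := d) Finset.univ s = Kop s := rfl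

theorem KF_empty (s : ℝ) : KF (d := d) ∅ s = 1 := by
  unfold KF; simp

theorem KF_insert (F : Finset (Fin d)) (i : Fin d) (hi : i ∉ F) (s : ℝ) :
    KF (insert i F) s = Jop s i * KF F s := by
  unfold KF Jop
  rw [Finset.sum_insert hi, smul_add]
  refine exp_add' ?_
  exact ((Commute.sum_right _ _ _ fun j _ => Ti_comm i j).smul_left _).smul_right _

theorem J_sh (s : ℝ) (i : Fin d) (v : Zd d) : Commute (Jop s i) (sh v) := by
  unfold Jop
  exact Commute.exp_left ((Ti_sh i v).smul_left _)

theorem KF_nonneg (F : Finset (Fin d)) {s : ℝ} (hs : 0 ≤ s) (h : E d) (hh : ∀ y, 0 ≤ h y) (y : Zd d) :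
    0 ≤ KF F s h y := by
  induction F using Finset.induction_on generalizing y with
  | empty => rw [KF_empty]; exact hh y
  | insert i F hi ih =>
    rw [KF_insert F i hi]
    exact J_nonneg hs i _ ih y

theorem KF_mono (F : Finset (Fin d)) {s : ℝ} (hs : 0 ≤ s) (h g : E d) (hh : ∀ y, h y ≤ g y) (y : Zd d) :
    KF F s h y ≤ KF F s g y := by
  have := KF_nonneg F hs (g - h) (fun y => by rw [E.sub_apply]; linarith [hh y]) y
  rw [map_sub, E.sub_apply] at this
  linarith

theorem J_mono {s : ℝ} (hs : 0 ≤ s) (i : Fin d) (h g : E d) (hh : ∀ y, h y ≤ g y) (y : Zd d) :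
    Jop s i h y ≤ Jop s i g y := by
  have := J_nonneg hs i (g - h) (fun y => by rw [E.sub_apply]; linarith [hh y]) y
  rw [map_sub, E.sub_apply] at this
  linarith

theorem K_nonneg {s : ℝ} (hs : 0 ≤ s) (h : E d) (hh : ∀ y, 0 ≤ h y) (y : Zd d) :
    0 ≤ Kop s h y := KF_nonneg Finset.univ hs h hh y

theorem K_mono {s : ℝ} (hs : 0 ≤ s) (h g : E d) (hh : ∀ y, h y ≤ g y) (y : Zd d) :
    Kop s h y ≤ Kop s g y := KF_mono Finset.univ hs h g hh y

theorem K_one (s : ℝ) : Kop s (oneE d) = oneE d := by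
  unfold Kop
  refine exp_apply_of_zero _ _ ?_
  rw [_root_.smul_apply, _root_.sum_apply]
  simp [Ti_one]

theorem K_K (s t : ℝ) (h : E d) : Kop s (Kop t h) = Kop (s + t) h := by
  rw [Kop_add]; rfl

theorem KF_dl (F : Finset (Fin d)) {s : ℝ} (hs : 0 ≤ s) (w y : Zd d) :
    KF F s (dl w) y = if ∀ i, i ∉ F → w i = y i then ∏ i ∈ F, qk s (w i - y i) else 0 := by
  induction F using Finset.induction_on generalizing y with
  | empty =>
    rw [KF_empty]
    show dl w y = _
    rw [dl_apply]
    simp only [Finset.notMem_empty, not_false_eq_true, forall_const, Finset.prod_empty]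
    congr 1
    rw [funext_iff]
    exact propext ⟨fun h i => (h i).symm, fun h i => (h i).symm⟩
  | insert i F hi ih =>
    rw [KF_insert F i hi]
    have h0 : ∀ y, 0 ≤ KF F s (dl w) y := KF_nonneg F hs _ (dl_nonneg w)
    have h := J_hasSum hs i (KF F s (dl w)) h0 y
    refine h.unique ?_
    have h2 := hasSum_single (f := fun n : ℤ => qk s n * KF F s (dl w) (y + n • ev i)) (w i - y i) (by
      intro n hn
      rw [ih, if_neg, mul_zero]
      intro h
      have := h i hi
      simp [ev] at this
      omega)
    refine hasSum_cg h2 (fun n => rfl) ?_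
    rw [ih, Finset.prod_insert hi]
    have hne : ∀ j, j ≠ i → (y + (w i - y i) • ev i) j = y j := by
      intro j hj
      simp [ev, hj]
    have e1 : (∀ j, j ∉ insert i F → w j = y j) ↔
        (∀ j, j ∉ F → w j = (y + (w i - y i) • ev i) j) := by
      constructor
      · intro H j hj
        by_cases hji : j = i
        · subst hji; simp [ev]
        · rw [hne j hji]; exact H j (by simp [hji, hj])
      · intro H j hj
        simp only [Finset.mem_insert, not_or] at hj
        rw [H j hj.2, hne j hj.1]
    by_cases hc : ∀ j, j ∉ insert i F → w j = y j
    · rw [if_pos hc, if_pos (e1.1 hc)]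
      congr 1
      refine Finset.prod_congr rfl fun j hj => ?_
      rw [hne j (by rintro rfl; exact hi hj)]
    · rw [if_neg hc, if_neg (fun h => hc (e1.2 h)), mul_zero]

noncomputable def pk (s : ℝ) (x : Zd d) : ℝ := ∏ i, qk s (x i)

theorem K_dl {s : ℝ} (hs : 0 ≤ s) (w y : Zd d) : Kop s (dl w) y = pk s (w - y) := by
  rw [← KF_univ, KF_dl _ hs, if_pos (by simp)]
  rfl

theorem pk_nonneg {s : ℝ} (hs : 0 ≤ s) (x : Zd d) : 0 ≤ pk s x :=
  Finset.prod_nonneg fun _ _ => qk_nonneg hs _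

theorem J_cmp {s t C : ℝ} (hs : 0 ≤ s) (ht : 0 ≤ t) (k : ℤ)
    (H : ∀ n : ℤ, qk s n ≤ C * qk t (n - k)) (i : Fin d) (h : E d) (hh : ∀ y, 0 ≤ h y) (y : Zd d) :
    Jop s i h y ≤ C * Jop t i h (y + k • ev i) := by
  have h1 := J_hasSum hs i h hh y
  have h2 := (J_hasSum ht i h hh (y + k • ev i)).mul_left C
  have h3 := (Equiv.hasSum_iff (Equiv.subRight k)).2 h2
  refine hasSum_le (fun n => ?_) h1 h3
  show _ ≤ C * (qk t (n - k) * h (y + k • ev i + (n - k) • ev i))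
  rw [show y + k • ev i + (n - k) • ev i = y + n • ev i by rw [sub_smul]; abel, ← mul_assoc]
  exact mul_le_mul_of_nonneg_right (H n) (hh _)

theorem KF_cmp {s t C R : ℝ} (hs : 0 ≤ s) (ht : 0 ≤ t) (hC : 0 ≤ C)
    (H : ∀ n k : ℤ, |(k : ℝ)| ≤ R → qk s n ≤ C * qk t (n + k)) (F : Finset (Fin d)) (k : Zd d)
    (hk : ∀ i, |(k i : ℝ)| ≤ R) (h : E d) (hh : ∀ y, 0 ≤ h y) (y : Zd d) :
    KF F s h y ≤ C ^ F.card * KF F t h (y + ∑ i ∈ F, k i • ev i) := by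
  induction F using Finset.induction_on generalizing y with
  | empty => rw [KF_empty, KF_empty]; simp
  | insert i F hi ih =>
    rw [KF_insert F i hi, KF_insert F i hi, Finset.card_insert_of_notMem hi, Finset.sum_insert hi]
    show Jop s i (KF F s h) y ≤ C ^ (F.card + 1) * Jop t i (KF F t h) (y + (k i • ev i + ∑ j ∈ F, k j • ev j))
    have h1 := J_cmp hs ht (k i) (fun n => H n (-k i) (by push_cast; rw [abs_neg]; exact hk i)) i
      (KF F s h) (KF_nonneg F hs h hh) y
    set v := ∑ j ∈ F, k j • ev j with hv
    have h2 : Jop t i (KF F s h) (y + k i • ev i) ≤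
        Jop t i (C ^ F.card • sh v (KF F t h)) (y + k i • ev i) := by
      refine J_mono ht i _ _ (fun z => ?_) _
      rw [E.smul_apply, sh_apply]
      exact ih z
    rw [map_smul, E.smul_apply] at h2
    have h3 : Jop t i (sh v (KF F t h)) = sh v (Jop t i (KF F t h)) := by
      have := congrArg (fun A : Op d => A (KF F t h)) (J_sh t i v).eq
      exact this
    rw [h3, sh_apply, add_assoc] at h2
    calc _ ≤ _ := h1
      _ ≤ _ := mul_le_mul_of_nonneg_left h2 hC
      _ = _ := by rw [pow_succ]; ring

theorem sum_ev (k : Zd d) : ∑ i, k i • ev i = k := by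
  funext j
  simp [ev, Finset.sum_apply, Pi.single_apply]

theorem qk_Cmp2 : ∃ C ≥ 1, ∃ s0 ≥ 1, ∀ s t : ℝ, 0 < s → s ≤ t → t ≤ 2 * s → s0 ≤ t → ∀ n k : ℤ,
    |(k : ℝ)| ≤ √t → qk s n ≤ C * qk (2 * t) (n + k) := by
  obtain ⟨C, hC, s0, hs0, H⟩ := qk_Cmp
  refine ⟨2 * C + 1, by linarith, s0, hs0, ?_⟩
  intro s t hs hst hts ht n k hk
  refine (H s t hs hst ht n k hk).trans ?_
  have hq := qk_nonneg (show 0 ≤ 2 * t by linarith) (n + k)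
  have : √(t / s) ≤ 2 := by
    rw [Real.sqrt_le_left (by norm_num), div_le_iff₀ hs]; linarith
  gcongr
  nlinarith

theorem K_cmp (d : ℕ) : ∃ C ≥ 1, ∃ s0 ≥ 1, ∀ s t : ℝ, 0 < s → s ≤ t → t ≤ 2 * s → s0 ≤ t → ∀ k : Zd d,
    (∀ i, |(k i : ℝ)| ≤ √t) → ∀ (h : E d), (∀ y, 0 ≤ h y) → ∀ y,
      Kop s h y ≤ C * Kop (2 * t) h (y + k) := by
  obtain ⟨C, hC, s0, hs0, H⟩ := qk_Cmp2
  refine ⟨C ^ d, one_le_pow₀ hC, s0, hs0, ?_⟩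
  intro s t hs hst hts ht k hk h hh y
  have := KF_cmp hs.le (show 0 ≤ 2 * t by linarith) (by linarith) (H s t hs hst hts ht) Finset.univ k hk h hh y
  rwa [sum_ev, KF_univ, KF_univ, Finset.card_univ, Fintype.card_fin] at this

theorem pk_cmp (d : ℕ) : ∃ C ≥ 1, ∃ s0 ≥ 1, ∀ s t : ℝ, 0 < s → s ≤ t → t ≤ 2 * s → s0 ≤ t → ∀ k : Zd d,
    (∀ i, |(k i : ℝ)| ≤ √t) → ∀ x : Zd d, pk s x ≤ C * pk (2 * t) (x + k) := by
  obtain ⟨C, hC, s0, hs0, H⟩ := K_cmp d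
  refine ⟨C, hC, s0, hs0, ?_⟩
  intro s t hs hst hts ht k hk x
  have := H s t hs hst hts ht (-k) (by intro i; simpa using hk i) (dl x) (dl_nonneg x) 0
  rw [K_dl hs.le, K_dl (by linarith)] at this
  simpa using this

theorem K_grad (d : ℕ) : ∃ C > 0, ∃ s0 ≥ 1, ∀ s : ℝ, s0 ≤ s → ∀ (h : E d), (∀ y, 0 ≤ h y) → ∀ i y,
      |Kop s h y - Kop s h (y + ev i)| ≤ C / √s * Kop (2 * s) h y := by
  obtain ⟨C, hC, s0, hs0, H⟩ := qk_Grad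
  obtain ⟨C1, hC1, s1, hs1, H1⟩ := qk_Cmp2
  refine ⟨C * C1 ^ (d - 1), by positivity, s0 + s1, by linarith, ?_⟩
  intro s hs h hh i y
  have hsp : 0 < s := by linarith
  have e : ∀ u, Kop u = Jop u i * KF (d := d) (Finset.univ.erase i) u := by
    intro u
    rw [← KF_insert _ _ (Finset.notMem_erase _ _), Finset.insert_erase (Finset.mem_univ _), KF_univ]
  rw [e s, e (2 * s)]
  show |Jop s i (KF (Finset.univ.erase i) s h) y - Jop s i (KF (Finset.univ.erase i) s h) (y + ev i)| ≤
    C * C1 ^ (d - 1) / √s * Jop (2 * s) i (KF (Finset.univ.erase i) (2 * s) h) y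
  set g := KF (Finset.univ.erase i) s h with hg
  have hg0 : ∀ y, 0 ≤ g y := KF_nonneg _ hsp.le h hh
  have h1 := J_hasSum hsp.le i g hg0 y
  have h2 := (Equiv.hasSum_iff (Equiv.subRight 1)).2 (J_hasSum hsp.le i g hg0 (y + ev i))
  have h3 := h1.sub h2
  have h4 := (J_hasSum (show 0 ≤ 2 * s by linarith) i g hg0 y).mul_left (C / √s)
  have h5 : ∀ n : ℤ, |qk s n * g (y + n • ev i) -
      ((fun n : ℤ => qk s n * g (y + ev i + n • ev i)) ∘ Equiv.subRight 1) n| ≤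
      C / √s * (qk (2 * s) n * g (y + n • ev i)) := by
    intro n
    show |qk s n * g (y + n • ev i) - qk s (n - 1) * g (y + ev i + (n - 1) • ev i)| ≤ _
    rw [show y + ev i + (n - 1) • ev i = y + n • ev i by rw [sub_smul, one_smul]; abel, ← sub_mul,
      abs_mul, abs_of_nonneg (hg0 _), ← mul_assoc]
    refine mul_le_mul_of_nonneg_right ?_ (hg0 _)
    have := H s (by linarith) (-n)
    rwa [qk_symm, qk_symm, show -n + 1 = -(n - 1) by ring, qk_symm] at this
  have h6 : |Jop s i g y - Jop s i g (y + ev i)| ≤ C / √s * Jop (2 * s) i g y := by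
    rw [abs_le]
    refine ⟨?_, hasSum_le (fun n => (le_abs_self _).trans (h5 n)) h3 h4⟩
    exact hasSum_le (fun n => (neg_le_of_abs_le (h5 n))) h4.neg h3
  refine h6.trans ?_
  have h7 : Jop (2 * s) i g y ≤ Jop (2 * s) i (C1 ^ (d - 1) • KF (Finset.univ.erase i) (2 * s) h) y := by
    refine J_mono (by linarith) i _ _ (fun z => ?_) y
    have := KF_cmp hsp.le (show 0 ≤ 2 * s by linarith) (by linarith)
      (H1 s s hsp le_rfl (by linarith) (by linarith)) (Finset.univ.erase i) (0 : Zd d) (by simp) h hh z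
    rw [Finset.card_erase_of_mem (Finset.mem_univ _), Finset.card_univ, Fintype.card_fin] at this
    rw [E.smul_apply, hg]
    simpa using this
  rw [map_smul, E.smul_apply] at h7
  calc _ ≤ C / √s * _ := mul_le_mul_of_nonneg_left h7 (by positivity)
    _ = _ := by ring

theorem pk_upper {s : ℝ} (hs : 0 < s) (x : Zd d) : pk s x ≤ (4 / √s) ^ d := by
  unfold pk
  calc _ ≤ ∏ i : Fin d, (4 / √s) := Finset.prod_le_prod (fun _ _ => qk_nonneg hs.le _) (fun _ _ => qk_upper hs _)
    _ = _ := by rw [Finset.prod_const, Finset.card_univ, Fintype.card_fin]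

theorem pk_lower (d : ℕ) (A : ℝ) (hA : 1 ≤ A) : ∃ c > 0, ∃ s0 ≥ 1, ∀ s ≥ s0, ∀ x : Zd d,
    (∀ i, |(x i : ℝ)| ≤ A * √s) → (c / √s) ^ d ≤ pk s x := by
  obtain ⟨c, hc, s0, hs0, H⟩ := qk_lower A hA
  refine ⟨c, hc, s0, hs0, fun s hs x hx => ?_⟩
  unfold pk
  calc (c / √s) ^ d = ∏ i : Fin d, (c / √s) := by rw [Finset.prod_const, Finset.card_univ, Fintype.card_fin]
    _ ≤ _ := Finset.prod_le_prod (fun _ _ => by positivity) (fun i _ => H s hs _ (hx i))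

theorem pk_far (d : ℕ) (hd : 1 ≤ d) : ∃ C > 0, ∃ s0 ≥ 1, ∀ s t : ℝ, 0 < s → s ≤ t → s0 ≤ t → ∀ x : Zd d,
    (∃ i, √t ≤ |(x i : ℝ)|) → pk s x ≤ C * pk (2 * t) x := by
  obtain ⟨c, hc, s0, hs0, H⟩ := qk_L1 d hd
  obtain ⟨C, hC, s1, hs1, H1⟩ := qk_Cmp
  refine ⟨(1 / c) * (C + 1) ^ (d - 1), by positivity, s0 + s1, by linarith, ?_⟩
  rintro s t hs hst ht x ⟨i, hi⟩
  have ht0 : 0 < t := by linarith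
  set u := √(t / s) with hu
  have hu1 : 1 ≤ u := Real.one_le_sqrt.2 (by rw [le_div_iff₀ hs]; linarith)
  have hu2 : u ^ 2 = t / s := Real.sq_sqrt (by positivity)
  have q2 : ∀ n, 0 ≤ qk (2 * t) n := qk_nonneg (by linarith)
  have hbig : qk s (x i) ≤ (1 / c) * (1 / u ^ (2 * d)) * qk (2 * t) (x i) := by
    have h1 := H s t hs hst (by linarith) |x i| (by push_cast; exact hi)
    have e : ∀ r, qk r |x i| = qk r (x i) := by
      intro r
      rcases abs_choice (x i) with h | h <;> rw [h]
      rw [qk_symm]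
    rw [e, e] at h1
    have h2 : u ^ (2 * d) ≤ (√t * (|x i| : ℤ) / s) ^ d := by
      rw [pow_mul, hu2]
      push_cast
      refine pow_le_pow_left₀ (by positivity) ?_ d
      gcongr
      calc t = √t * √t := (Real.mul_self_sqrt ht0.le).symm
        _ ≤ _ := by gcongr
    have h3 : c * u ^ (2 * d) * qk s (x i) ≤ qk (2 * t) (x i) := by
      refine le_trans ?_ h1
      have := qk_nonneg hs.le (x i)
      gcongr
    calc qk s (x i) = (1 / c) * (1 / u ^ (2 * d)) * (c * u ^ (2 * d) * qk s (x i)) := by field_simp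
      _ ≤ _ := by gcongr
  have hoth : ∀ j, qk s (x j) ≤ (C + 1) * u * qk (2 * t) (x j) := by
    intro j
    have := H1 s t hs hst (by linarith) (x j) 0 (by simp)
    rw [add_zero] at this
    refine this.trans ?_
    have := q2 (x j)
    gcongr
    linarith
  unfold pk
  rw [← Finset.mul_prod_erase _ _ (Finset.mem_univ i), ← Finset.mul_prod_erase _ (fun i => qk (2 * t) (x i)) (Finset.mem_univ i)]
  have hprod : ∏ j ∈ Finset.univ.erase i, qk s (x j) ≤
      ((C + 1) * u) ^ (d - 1) * ∏ j ∈ Finset.univ.erase i, qk (2 * t) (x j) := by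
    calc _ ≤ ∏ j ∈ Finset.univ.erase i, ((C + 1) * u * qk (2 * t) (x j)) :=
          Finset.prod_le_prod (fun _ _ => qk_nonneg hs.le _) (fun j _ => hoth j)
      _ = _ := by
          rw [Finset.prod_mul_distrib, Finset.prod_const, Finset.card_erase_of_mem (Finset.mem_univ _),
            Finset.card_univ, Fintype.card_fin]
  set Q := ∏ j ∈ Finset.univ.erase i, qk (2 * t) (x j) with hQ
  have hQ0 : 0 ≤ Q := Finset.prod_nonneg fun _ _ => q2 _
  have hfin : 1 / u ^ (2 * d) * u ^ (d - 1) ≤ 1 := by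
    rw [div_mul_eq_mul_div, one_mul, div_le_one (by positivity)]
    exact pow_le_pow_right₀ hu1 (by omega)
  have qi := q2 (x i)
  calc _ ≤ ((1 / c) * (1 / u ^ (2 * d)) * qk (2 * t) (x i)) * (((C + 1) * u) ^ (d - 1) * Q) :=
        mul_le_mul hbig hprod (Finset.prod_nonneg fun _ _ => qk_nonneg hs.le _) (by positivity)
    _ = (1 / c) * (C + 1) ^ (d - 1) * (qk (2 * t) (x i) * Q) * (1 / u ^ (2 * d) * u ^ (d - 1)) := by
        rw [mul_pow]; ring
    _ ≤ (1 / c) * (C + 1) ^ (d - 1) * (qk (2 * t) (x i) * Q) * 1 := by gcongr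
    _ = _ := by ring

theorem K_dl_cont (w y : Zd d) : Continuous (fun s => (Kop s (dl w) : E d) y) :=
  continuous_iff_continuousAt.2 fun s => (Kop_deriv (dl w) y s).continuousAt

theorem K_int {ι : Type*} (h : E d) (S : Finset ι) (e : ι → ℝ) (p : ι → Zd d)
    (hT : (∑ i, Ti (d := d) i) h = ∑ w ∈ S, e w • dl (p w)) (a b : ℝ) (y : Zd d) :
    Kop b h y - Kop a h y = ∑ w ∈ S, e w * ∫ s in a..b, (Kop s (dl (p w)) : E d) y := by
  have e1 : ∀ s, (Kop s ((∑ i, Ti (d := d) i) h) : E d) y =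
      ∑ w ∈ S, e w * (Kop s (dl (p w)) : E d) y := by
    intro s
    rw [hT, map_sum, ← evC_apply, map_sum]
    refine Finset.sum_congr rfl fun w _ => ?_
    rw [map_smul]
    rfl
  have h1 := intervalIntegral.integral_eq_sub_of_hasDerivAt (a := a) (b := b)
    (f := fun u => (Kop u h : E d) y)
    (fun s _ => Kop_deriv h y s) (by
      apply Continuous.intervalIntegrable
      simp only [e1]
      exact continuous_finsetSum _ fun w _ => (K_dl_cont (p w) y).const_mul _)
  rw [← h1]
  simp only [e1]
  rw [intervalIntegral.integral_finsetSum]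
  · simp only [intervalIntegral.integral_const_mul]
  · intro w _
    exact ((K_dl_cont (p w) y).const_mul _).intervalIntegrable _ _

end Aux11

namespace Aux11

structure Cfg (d L K : ℕ) (Z D0 : Finset (Zd d)) (h : E d) (e : Zd d → ℝ) : Prop where
  hL : 1 ≤ L
  hD : ∀ v ∈ D0, ∀ i, |v i| ≤ 4 * L
  sep : ∀ z ∈ Z, ∀ z' ∈ Z, z ≠ z' → ∃ i, (2 * K + 3) * (L : ℤ) ≤ |z i - z' i|
  h0 : ∀ y, 0 ≤ h y
  h1 : ∀ y, h y ≤ 1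
  e0 : ∀ y, 0 ≤ e y
  hT : (∑ i, Ti (d := d) i) h = ∑ z ∈ Z, ∑ v ∈ D0, e (z + v) • dl (z + v)

variable {d L K : ℕ} {Z D0 : Finset (Zd d)} {h : E d} {e : Zd d → ℝ}

theorem Cfg.int (c : Cfg d L K Z D0 h e) (a b : ℝ) (y : Zd d) :
    Kop b h y - Kop a h y =
      ∑ z ∈ Z, ∑ v ∈ D0, e (z + v) * ∫ s in a..b, (Kop s (dl (z + v)) : E d) y := by
  have := K_int h (Z ×ˢ D0) (fun p => e (p.1 + p.2)) (fun p => p.1 + p.2)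
    (by rw [Finset.sum_product]; exact c.hT) a b y
  rw [Finset.sum_product] at this
  exact this

theorem int_le {a b B : ℝ} (ha : 0 ≤ a) (hab : a ≤ b) (w y : Zd d)
    (H : ∀ s, a < s → s ≤ b → pk s (w - y) ≤ B) :
    ∫ s in a..b, (Kop s (dl w) : E d) y ≤ B * (b - a) := by
  have h1 := intervalIntegral.norm_integral_le_of_norm_le_const (a := a) (b := b) (C := B)
    (f := fun s => (Kop s (dl w) : E d) y) (by
      intro s hs
      rw [Set.uIoc_of_le hab] at hs
      rw [K_dl (by linarith [hs.1]), Real.norm_eq_abs, abs_of_nonneg (pk_nonneg (by linarith [hs.1]) _)]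
      exact H s hs.1 hs.2)
  rw [abs_of_nonneg (by linarith)] at h1
  exact (le_abs_self _).trans h1

theorem int_ge {a b B : ℝ} (ha : 0 ≤ a) (hab : a ≤ b) (w y : Zd d)
    (H : ∀ s, a ≤ s → s ≤ b → B ≤ pk s (w - y)) :
    B * (b - a) ≤ ∫ s in a..b, (Kop s (dl w) : E d) y := by
  have h1 := intervalIntegral.integral_mono_on (μ := MeasureTheory.volume) (a := a) (b := b) hab (f := fun _ => B)
    (g := fun s => (Kop s (dl w) : E d) y) (continuous_const.intervalIntegrable _ _) ((K_dl_cont w y).intervalIntegrable _ _) (by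
      intro s hs
      rw [K_dl (by linarith [hs.1])]
      exact H s hs.1 hs.2)
  rw [intervalIntegral.integral_const, smul_eq_mul] at h1
  linarith

theorem Cfg.mono (c : Cfg d L K Z D0 h e) {a b : ℝ} (ha : 0 ≤ a) (hab : a ≤ b) (y : Zd d) :
    Kop a h y ≤ Kop b h y := by
  have := c.int a b y
  have h2 : 0 ≤ ∑ z ∈ Z, ∑ v ∈ D0, e (z + v) * ∫ s in a..b, (Kop s (dl (z + v)) : E d) y := by
    refine Finset.sum_nonneg fun z _ => Finset.sum_nonneg fun v _ => mul_nonneg (c.e0 _) ?_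
    have := int_ge (B := 0) ha hab (z + v) y (fun s hs _ => pk_nonneg (by linarith) _)
    linarith
  linarith

theorem Cfg.le_one (c : Cfg d L K Z D0 h e) {a : ℝ} (ha : 0 ≤ a) (y : Zd d) : Kop a h y ≤ 1 := by
  have := K_mono ha h (oneE d) c.h1 y
  rw [K_one] at this
  exact this

theorem Cfg.nonneg (c : Cfg d L K Z D0 h e) {a : ℝ} (ha : 0 ≤ a) (y : Zd d) : 0 ≤ Kop a h y :=
  K_nonneg ha h c.h0 y

theorem stepA (d : ℕ) : ∃ C > 0, ∃ T0 : ℕ, ∀ (T L K : ℕ) (Z D0 : Finset (Zd d)) (h : E d) (e : Zd d → ℝ),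
    Cfg d L K Z D0 h e → T0 ≤ T → ∀ z ∈ Z,
    (L : ℝ) ^ 2 * ∑ v ∈ D0, e (z + v) ≤ C * (L : ℝ) ^ d * Kop (((T : ℝ) * L) ^ 2) h z := by
  obtain ⟨c, hc, s0, hs0, H⟩ := pk_lower d 1 le_rfl
  set a : ℕ := 4 + ⌈s0⌉₊ with ha
  have ha4 : (4 : ℝ) ≤ a := by rw [ha]; push_cast; linarith [Nat.cast_nonneg (α := ℝ) ⌈s0⌉₊]
  have has : s0 ≤ a := by rw [ha]; push_cast; linarith [Nat.le_ceil s0]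
  refine ⟨(2 * a / c) ^ d, by positivity, 2 * a, ?_⟩
  intro T L K Z D0 h e cf hT z hz
  have hL : (1 : ℝ) ≤ L := by exact_mod_cast cf.hL
  have hT' : 2 * (a : ℝ) ≤ T := by exact_mod_cast hT
  set α : ℝ := ((a : ℝ) * L) ^ 2 with hα
  have hα0 : 0 ≤ α := by positivity
  have hsα : √α = a * L := Real.sqrt_sq (by positivity)
  have hLa : (L : ℝ) ^ 2 ≤ α := by rw [hα]; gcongr; nlinarith
  have h1 := cf.int α (2 * α) z
  have h2 := cf.nonneg hα0 z
  have h3 : Kop (2 * α) h z ≤ Kop (((T : ℝ) * L) ^ 2) h z := by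
    refine cf.mono (by positivity) ?_ z
    calc 2 * α ≤ (2 * a * L) ^ 2 := by rw [hα]; nlinarith [sq_nonneg ((a : ℝ) * L)]
      _ ≤ _ := by gcongr
  have hpk : ∀ v ∈ D0, ∀ s, α ≤ s → s ≤ 2 * α → (c / (2 * a * L)) ^ d ≤ pk s (z + v - z) := by
    intro v hv s hs1 hs2
    have hsq1 : a * L ≤ √s := by rw [← hsα]; exact Real.sqrt_le_sqrt hs1
    have hsq2 : √s ≤ 2 * a * L := by
      rw [Real.sqrt_le_left (by positivity)]
      calc s ≤ 2 * α := hs2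
        _ ≤ _ := by rw [hα]; nlinarith [sq_nonneg ((a : ℝ) * L)]
    have hsp : 0 < √s := lt_of_lt_of_le (by positivity) hsq1
    refine le_trans ?_ (H s ?_ _ ?_)
    · gcongr
    · refine has.trans (le_trans ?_ hs1)
      rw [hα]
      have : (a:ℝ) ≤ a*L := by nlinarith
      nlinarith
    · intro i
      rw [add_sub_cancel_left, one_mul]
      have h5 : ((|v i| : ℤ) : ℝ) ≤ ((4 * L : ℤ) : ℝ) := by exact_mod_cast cf.hD v hv i
      push_cast at h5
      nlinarith
  have h4 : ∑ v ∈ D0, e (z + v) * ((c / (2 * a * L)) ^ d * (L : ℝ) ^ 2) ≤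
      ∑ z' ∈ Z, ∑ v ∈ D0, e (z' + v) * ∫ s in α..(2 * α), (Kop s (dl (z' + v)) : E d) z := by
    have this2 : ∀ z' ∈ Z, 0 ≤ ∑ v ∈ D0, e (z' + v) * ∫ s in α..(2 * α), (Kop s (dl (z' + v)) : E d) z := by
      intro z' _
      refine Finset.sum_nonneg fun v _ => mul_nonneg (cf.e0 _) ?_
      have := int_ge (B := 0) hα0 (show α ≤ 2 * α by linarith) (z' + v) z (fun s hs _ => pk_nonneg (by linarith) _)
      linarith
    refine le_trans ?_ (Finset.single_le_sum this2 hz)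
    refine Finset.sum_le_sum fun v hv => mul_le_mul_of_nonneg_left ?_ (cf.e0 _)
    refine le_trans ?_ (int_ge hα0 (show α ≤ 2 * α by linarith) (z + v) z (hpk v hv))
    gcongr
    linarith
  rw [← Finset.sum_mul] at h4
  have h6 : (∑ v ∈ D0, e (z + v)) * ((c / (2 * a * L)) ^ d * (L : ℝ) ^ 2) ≤ Kop (((T : ℝ) * L) ^ 2) h z := by
    linarith
  calc (L : ℝ) ^ 2 * ∑ v ∈ D0, e (z + v)
      = (2 * a / c) ^ d * (L : ℝ) ^ d * ((∑ v ∈ D0, e (z + v)) * ((c / (2 * a * L)) ^ d * (L : ℝ) ^ 2)) := by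
        have : (2 * a / c) ^ d * (L : ℝ) ^ d * (c / (2 * a * L)) ^ d = 1 := by
          rw [← mul_pow, ← mul_pow]
          rw [show 2 * (a : ℝ) / c * L * (c / (2 * a * L)) = 1 by field_simp, one_pow]
        linear_combination (-(L : ℝ) ^ 2 * ∑ v ∈ D0, e (z + v)) * this
    _ ≤ _ := by gcongr

theorem K_sum_le {s : ℝ} (hs : 0 ≤ s) (U : Finset (Zd d)) (g : E d) (hg : ∀ y, 0 ≤ g y) (y : Zd d) :
    ∑ u ∈ U, g u * pk s (u - y) ≤ Kop s g y := by
  have h1 := K_mono hs (∑ u ∈ U, g u • dl u) g (by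
    intro x
    rw [← evC_apply, map_sum]
    simp only [map_smul, evC_apply, dl_apply, smul_eq_mul, mul_ite, mul_one, mul_zero]
    rw [Finset.sum_ite_eq]
    split_ifs
    · exact le_rfl
    · exact hg x) y
  rw [map_sum, ← evC_apply, map_sum] at h1
  refine le_trans (le_of_eq (Finset.sum_congr rfl fun u _ => ?_)) h1
  rw [map_smul, map_smul, evC_apply, K_dl hs, smul_eq_mul]

theorem stepB (d : ℕ) (hd : 3 ≤ d) : ∃ C > 0, ∃ T0 : ℕ, ∀ (T L K : ℕ) (Z D0 : Finset (Zd d)) (h : E d)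
    (e : Zd d → ℝ), Cfg d L K Z D0 h e → T0 ≤ T → T ≤ K → ∀ y,
    ((T : ℝ) * L) ^ 2 * ∑ z ∈ Z, ∑ v ∈ D0, e (z + v) * pk (4 * ((T : ℝ) * L) ^ 2) (z + v - y) ≤
      C / T * Kop (10 * ((T : ℝ) * L) ^ 2) h y := by
  obtain ⟨CA, hCA, TA, HA⟩ := stepA d
  obtain ⟨C1, hC1, s1, hs1, H1⟩ := K_cmp d
  obtain ⟨C2, hC2, s2, hs2, H2⟩ := pk_cmp d
  refine ⟨C1 * C2 * CA, by positivity, TA + 4 + ⌈s1⌉₊ + ⌈s2⌉₊, ?_⟩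
  intro T L K Z D0 h e cf hT hTK y
  have hL : (1 : ℝ) ≤ L := by exact_mod_cast cf.hL
  have hT' : (TA : ℝ) + 4 + ⌈s1⌉₊ + ⌈s2⌉₊ ≤ T := by exact_mod_cast hT
  have n1 := Nat.cast_nonneg (α := ℝ) TA
  have n2 := Nat.cast_nonneg (α := ℝ) ⌈s1⌉₊
  have n3 := Nat.cast_nonneg (α := ℝ) ⌈s2⌉₊
  have c1 := Nat.le_ceil s1
  have c2 := Nat.le_ceil s2
  have hT4 : (4 : ℝ) ≤ T := by linarith
  set N : ℝ := (T : ℝ) * L with hN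
  have hN4 : 4 * (L : ℝ) ≤ N := by rw [hN]; gcongr
  have hN1 : (T : ℝ) ≤ N := by rw [hN]; nlinarith
  have hN0 : 0 < N := by linarith
  set t : ℝ := N ^ 2 with ht
  have htT : (T : ℝ) ≤ t := by rw [ht]; nlinarith
  have ht0 : 0 < t := by positivity
  have hst : √t = N := Real.sqrt_sq hN0.le
  have hst4 : √(4 * t) = 2 * N := by
    rw [show 4 * t = (2 * N) ^ 2 by rw [ht]; ring]; exact Real.sqrt_sq (by linarith)
  set B : Finset (Zd d) := Fintype.piFinset (fun _ => Finset.Ico (0 : ℤ) ((T * L : ℕ) : ℤ)) with hB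
  have hBcard : (B.card : ℝ) = (T : ℝ) ^ d * (L : ℝ) ^ d := by
    rw [hB, Fintype.card_piFinset]
    simp only [Int.card_Ico, sub_zero, Int.toNat_natCast, Finset.prod_const, Finset.card_univ, Fintype.card_fin]
    push_cast
    rw [mul_pow]
  have hBm : ∀ u ∈ B, ∀ i, (0 : ℝ) ≤ u i ∧ (u i : ℝ) ≤ N := by
    intro u hu i
    rw [hB, Fintype.mem_piFinset] at hu
    have h1 := Finset.mem_Ico.1 (hu i)
    refine ⟨by exact_mod_cast h1.1, ?_⟩
    have : (u i : ℝ) < ((T * L : ℕ) : ℝ) := by exact_mod_cast h1.2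
    push_cast at this
    linarith
  have key : ∀ z ∈ Z, ∀ u ∈ B, (L : ℝ) ^ 2 * ∑ v ∈ D0, e (z + v) * pk (4 * t) (z + v - y) ≤
      C1 * C2 * CA * (L : ℝ) ^ d * (Kop (2 * t) h (z + u) * pk (8 * t) (z + u - y)) := by
    intro z hz u hu
    have hp0 : 0 ≤ pk (8 * t) (z + u - y) := pk_nonneg (by positivity) _
    have e1 : ∑ v ∈ D0, e (z + v) * pk (4 * t) (z + v - y) ≤
        (∑ v ∈ D0, e (z + v)) * (C2 * pk (8 * t) (z + u - y)) := by
      rw [Finset.sum_mul]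
      refine Finset.sum_le_sum fun v hv => mul_le_mul_of_nonneg_left ?_ (cf.e0 _)
      have := H2 (4 * t) (4 * t) (by positivity) le_rfl (by linarith) (by linarith) (u - v) (by
        intro i
        rw [hst4, abs_le]
        have h5 : ((|v i| : ℤ) : ℝ) ≤ ((4 * L : ℤ) : ℝ) := by exact_mod_cast cf.hD v hv i
        push_cast at h5
        rw [abs_le] at h5
        have := hBm u hu i
        simp only [Pi.sub_apply, Int.cast_sub]
        constructor <;> linarith) (z + v - y)
      rw [show z + v - y + (u - v) = z + u - y by abel, show 2 * (4 * t) = 8 * t by ring] at this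
      exact this
    have e2 := HA T L K Z D0 h e cf (by omega) z hz
    have e3 : Kop t h z ≤ C1 * Kop (2 * t) h (z + u) :=
      H1 t t ht0 le_rfl (by linarith) (by linarith) u (by
        intro i
        rw [hst, abs_le]
        have := hBm u hu i
        constructor <;> linarith) h cf.h0 z
    calc _ ≤ (L : ℝ) ^ 2 * ((∑ v ∈ D0, e (z + v)) * (C2 * pk (8 * t) (z + u - y))) := by gcongr
      _ = ((L : ℝ) ^ 2 * ∑ v ∈ D0, e (z + v)) * (C2 * pk (8 * t) (z + u - y)) := by ring
      _ ≤ (CA * (L : ℝ) ^ d * (C1 * Kop (2 * t) h (z + u))) * (C2 * pk (8 * t) (z + u - y)) := by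
          refine mul_le_mul_of_nonneg_right (e2.trans ?_) (by positivity)
          gcongr
      _ = _ := by ring
  have hinj : Set.InjOn (fun p : Zd d × Zd d => p.1 + p.2) ((Z ×ˢ B : Finset (Zd d × Zd d)) : Set (Zd d × Zd d)) := by
    rintro ⟨z, u⟩ hp ⟨z', u'⟩ hp' heq
    rw [Finset.mem_coe, Finset.mem_product] at hp hp'
    simp only at heq hp hp'
    have hz : z = z' := by
      by_contra hne
      obtain ⟨i, hi⟩ := cf.sep z hp.1 z' hp'.1 hne
      have h1 := hp.2
      have h2 := hp'.2
      rw [hB, Fintype.mem_piFinset] at h1 h2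
      have h1 := Finset.mem_Ico.1 (h1 i)
      have h2 := Finset.mem_Ico.1 (h2 i)
      have h3 := congrFun heq i
      simp only [Pi.add_apply] at h3
      have h4 : |z i - z' i| < ((T * L : ℕ) : ℤ) := by
        rw [abs_lt]; constructor <;> omega
      have h5 : ((T * L : ℕ) : ℤ) ≤ (2 * K + 3) * (L : ℤ) := by
        push_cast
        gcongr
        have : (T : ℤ) ≤ K := by exact_mod_cast hTK
        have : (0 : ℤ) ≤ K := by positivity
        linarith
      omega
    subst hz
    simpa using heq
  have hsum : ∑ z ∈ Z, ∑ u ∈ B, Kop (2 * t) h (z + u) * pk (8 * t) (z + u - y) ≤ Kop (10 * t) h y := by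
    have h1 := K_sum_le (s := 8 * t) (by positivity) ((Z ×ˢ B).image (fun p => p.1 + p.2)) (Kop (2 * t) h)
      (cf.nonneg (by positivity)) y
    rw [Finset.sum_image hinj, Finset.sum_product, K_K, show 8 * t + 2 * t = 10 * t by ring] at h1
    exact h1
  set S := ∑ z ∈ Z, ∑ v ∈ D0, e (z + v) * pk (4 * t) (z + v - y) with hS
  have h7 : (T : ℝ) ^ d * (L : ℝ) ^ d * ((L : ℝ) ^ 2 * S) ≤ C1 * C2 * CA * (L : ℝ) ^ d * Kop (10 * t) h y := by
    calc (T : ℝ) ^ d * (L : ℝ) ^ d * ((L : ℝ) ^ 2 * S)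
        = ∑ z ∈ Z, ∑ u ∈ B, (L : ℝ) ^ 2 * ∑ v ∈ D0, e (z + v) * pk (4 * t) (z + v - y) := by
          simp only [Finset.sum_const, nsmul_eq_mul]
          rw [hBcard, ← Finset.mul_sum, ← Finset.mul_sum]
      _ ≤ ∑ z ∈ Z, ∑ u ∈ B, C1 * C2 * CA * (L : ℝ) ^ d * (Kop (2 * t) h (z + u) * pk (8 * t) (z + u - y)) :=
          Finset.sum_le_sum fun z hz => Finset.sum_le_sum fun u hu => key z hz u hu
      _ = C1 * C2 * CA * (L : ℝ) ^ d * ∑ z ∈ Z, ∑ u ∈ B, Kop (2 * t) h (z + u) * pk (8 * t) (z + u - y) := by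
          simp only [Finset.mul_sum]
      _ ≤ _ := by gcongr
  have hLd : 0 < (L : ℝ) ^ d := by positivity
  have h8 : (T : ℝ) ^ d * ((L : ℝ) ^ 2 * S) ≤ C1 * C2 * CA * Kop (10 * t) h y := by
    refine le_of_mul_le_mul_left ?_ hLd
    linarith
  have hS0 : 0 ≤ S := Finset.sum_nonneg fun z _ => Finset.sum_nonneg fun v _ =>
    mul_nonneg (cf.e0 _) (pk_nonneg (by positivity) _)
  have hTd : (T : ℝ) ^ 3 ≤ (T : ℝ) ^ d := pow_le_pow_right₀ (by linarith) hd
  have hT0 : (0 : ℝ) < T := by linarith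
  calc t * S = (T : ℝ) ^ 3 * ((L : ℝ) ^ 2 * S) / T := by rw [ht, hN]; field_simp
    _ ≤ (T : ℝ) ^ d * ((L : ℝ) ^ 2 * S) / T := by gcongr
    _ ≤ C1 * C2 * CA * Kop (10 * t) h y / T := by gcongr
    _ = _ := by ring

theorem boot (d : ℕ) (hd : 3 ≤ d) : ∃ T0 : ℕ, ∀ (T L K : ℕ) (Z D0 : Finset (Zd d)) (h : E d)
    (e : Zd d → ℝ), Cfg d L K Z D0 h e → T0 ≤ T → T ≤ K → ∀ (j : ℕ) y,
    Kop (((j : ℝ) + 1) * ((T : ℝ) * L) ^ 2) h y ≤ 2 ^ j * Kop (((T : ℝ) * L) ^ 2) h y := by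
  obtain ⟨CB, hCB, TB, HB⟩ := stepB d hd
  obtain ⟨C2, hC2, s2, hs2, H2⟩ := pk_cmp d
  refine ⟨TB + 1 + ⌈s2⌉₊ + ⌈1024 * (C2 * CB)⌉₊, ?_⟩
  intro T L K Z D0 h e cf hT hTK
  have hL : (1 : ℝ) ≤ L := by exact_mod_cast cf.hL
  have hT' : (TB : ℝ) + 1 + ⌈s2⌉₊ + ⌈1024 * (C2 * CB)⌉₊ ≤ T := by exact_mod_cast hT
  have n1 := Nat.cast_nonneg (α := ℝ) TB
  have n2 := Nat.cast_nonneg (α := ℝ) ⌈s2⌉₊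
  have n3 := Nat.cast_nonneg (α := ℝ) ⌈1024 * (C2 * CB)⌉₊
  have c1 := Nat.le_ceil s2
  have c2 := Nat.le_ceil (1024 * (C2 * CB))
  have hT0 : (0 : ℝ) < T := by linarith
  have hTC : C2 * CB / T ≤ 1 / 1024 := by
    rw [div_le_div_iff₀ hT0 (by norm_num)]; linarith
  set t : ℝ := ((T : ℝ) * L) ^ 2 with ht
  have htT : (T : ℝ) ≤ t := by
    rw [ht]
    have : (T : ℝ) ≤ T * L := by nlinarith
    nlinarith
  have ht0 : 0 < t := by linarith
  have hinc : ∀ y, Kop (2 * t) h y - Kop t h y ≤ 1 / 1024 * Kop (10 * t) h y := by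
    intro y
    rw [cf.int t (2 * t) y]
    have hB := HB T L K Z D0 h e cf (by omega) hTK y
    calc _ ≤ ∑ z ∈ Z, ∑ v ∈ D0, C2 * (t * (e (z + v) * pk (4 * t) (z + v - y))) := by
          refine Finset.sum_le_sum fun z _ => Finset.sum_le_sum fun v _ => ?_
          have : ∫ s in t..(2 * t), (Kop s (dl (z + v)) : E d) y ≤
              C2 * pk (4 * t) (z + v - y) * (2 * t - t) := by
            refine int_le ht0.le (by linarith) _ _ fun s hs1 hs2 => ?_
            have := H2 s (2 * t) (by linarith) (by linarith) (by linarith) (by linarith) 0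
              (by intro i; simp) (z + v - y)
            rw [add_zero, show 2 * (2 * t) = 4 * t by ring] at this
            exact this
          calc _ ≤ e (z + v) * (C2 * pk (4 * t) (z + v - y) * (2 * t - t)) :=
                mul_le_mul_of_nonneg_left this (cf.e0 _)
            _ = _ := by ring
      _ = C2 * (t * ∑ z ∈ Z, ∑ v ∈ D0, e (z + v) * pk (4 * t) (z + v - y)) := by
          simp only [Finset.mul_sum]
      _ ≤ C2 * (CB / T * Kop (10 * t) h y) := by gcongr
      _ = C2 * CB / T * Kop (10 * t) h y := by ring
      _ ≤ _ := by
          have := cf.nonneg (show 0 ≤ 10 * t by positivity) y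
          gcongr
  have iter : ∀ s : ℝ, 0 ≤ s → (∀ y, Kop (2 * t) h y ≤ 2 * Kop t h y + s) → ∀ (j : ℕ) y,
      Kop (((j : ℝ) + 1) * t) h y + s ≤ 2 ^ j * (Kop t h y + s) := by
    intro s hs H j
    induction j with
    | zero => intro y; simp
    | succ j ih =>
      intro y
      have h1 := K_mono (s := (j : ℝ) * t) (by positivity) (Kop (2 * t) h) ((2 : ℝ) • Kop t h + s • oneE d)
        (by intro x; exact (H x).trans (le_of_eq (by
              rw [E.add_apply, E.smul_apply, E.smul_apply]; simp [oneE, mkE_apply]))) y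
      rw [map_add, map_smul, map_smul, K_one, K_K, K_K, E.add_apply, E.smul_apply, E.smul_apply] at h1
      have e1 : oneE d y = 1 := rfl
      rw [e1, show (j : ℝ) * t + 2 * t = ((j : ℝ) + 1 + 1) * t by ring,
        show (j : ℝ) * t + t = ((j : ℝ) + 1) * t by ring] at h1
      have := ih y
      push_cast
      rw [pow_succ]
      linarith
  have claim : ∀ n : ℕ, ∀ y, Kop (2 * t) h y ≤ 2 * Kop t h y + (1 / 2) ^ n := by
    intro n
    induction n with
    | zero =>
      intro y
      have := cf.le_one (show 0 ≤ 2 * t by positivity) y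
      have := cf.nonneg ht0.le y
      simp
      linarith
    | succ n ih =>
      intro y
      have h1 := iter ((1 / 2) ^ n) (by positivity) ih 9 y
      have h2 := hinc y
      have h3 : (0 : ℝ) < (1 / 2) ^ n := by positivity
      have h4 := cf.nonneg ht0.le y
      rw [pow_succ]
      norm_num only at h1 h2 h3 ⊢
      linarith
  have hfin : ∀ y, Kop (2 * t) h y ≤ 2 * Kop t h y + 0 := by
    intro y
    refine ge_of_tendsto' (x := Filter.atTop) (f := fun n : ℕ => 2 * Kop t h y + (1 / 2 : ℝ) ^ n) ?_ (fun n => claim n y)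
    exact (_root_.tendsto_pow_atTop_nhds_zero_of_lt_one (r := (1/2:ℝ)) (by norm_num) (by norm_num)).const_add _
  intro j y
  have := iter 0 le_rfl hfin j y
  simpa using this

end Aux11

namespace Aux11

variable {d L K : ℕ} {Z D0 : Finset (Zd d)} {h : E d} {e : Zd d → ℝ}

theorem Kop_zero (h : E d) : Kop 0 h = h := by
  simp [Kop]

theorem natAbs_sum_pm (y z : Zd d) (i : Fin d) (a : ℤ) (h : (y i + a - z i).natAbs + 1 = (y i - z i).natAbs) :
    ∑ j, ((y + Pi.single i a : Zd d) j - z j).natAbs + 1 = ∑ j, (y j - z j).natAbs := by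
  rw [← Finset.add_sum_erase Finset.univ _ (Finset.mem_univ i),
    ← Finset.add_sum_erase Finset.univ (fun j => (y j - z j).natAbs) (Finset.mem_univ i)]
  have : ∑ x ∈ Finset.univ.erase i, ((y + Pi.single i a : Zd d) x - z x).natAbs
      = ∑ x ∈ Finset.univ.erase i, (y x - z x).natAbs := by
    refine Finset.sum_congr rfl fun x hx => ?_
    rw [Pi.add_apply, Pi.single_eq_of_ne (Finset.ne_of_mem_erase hx), add_zero]
  rw [this]
  simp only [Pi.add_apply, Pi.single_eq_same]
  omega

theorem path (g : Zd d → ℝ) (z : Zd d) (R : ℤ) (β : ℝ)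
    (hβ : ∀ i v, (∀ j, |v j - z j| ≤ R) → |g v - g (v + ev i)| ≤ β) :
    ∀ (n : ℕ) (y : Zd d), (∀ j, |y j - z j| ≤ R) → ∑ i, (y i - z i).natAbs = n → |g y - g z| ≤ β * n := by
  intro n
  induction n with
  | zero =>
    intro y hy hs
    rw [Finset.sum_eq_zero_iff] at hs
    have : y = z := by
      funext i
      have := hs i (Finset.mem_univ i)
      omega
    subst this
    simp
  | succ n ih =>
    intro y hy hs
    have : ∃ i, y i ≠ z i := by
      by_contra hcon
      push Not at hcon
      rw [Finset.sum_eq_zero (fun i _ => by rw [hcon i]; simp)] at hs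
      omega
    obtain ⟨i, hi⟩ := this
    rcases lt_or_gt_of_ne hi with hlt | hgt
    · have h1 := natAbs_sum_pm y z i 1 (by omega)
      have hy' : ∀ j, |(y + ev i : Zd d) j - z j| ≤ R := by
        intro j
        have := hy j
        rw [abs_le] at this ⊢
        by_cases hj : j = i
        · subst hj
          simp only [ev, Pi.add_apply, Pi.single_eq_same]
          omega
        · simp only [ev, Pi.add_apply, Pi.single_eq_of_ne hj]
          omega
      have h2 := ih (y + ev i) hy' (by simp only [ev]; omega)
      have h3 := hβ i y hy
      push_cast
      calc |g y - g z| = |(g y - g (y + ev i)) + (g (y + ev i) - g z)| := by ring_nf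
        _ ≤ _ := abs_add_le _ _
        _ ≤ _ := by linarith
    · have h1 := natAbs_sum_pm y z i (-1) (by omega)
      have hy' : ∀ j, |(y + Pi.single i (-1) : Zd d) j - z j| ≤ R := by
        intro j
        have := hy j
        rw [abs_le] at this ⊢
        by_cases hj : j = i
        · subst hj
          simp only [Pi.add_apply, Pi.single_eq_same]
          omega
        · simp only [Pi.add_apply, Pi.single_eq_of_ne hj]
          omega
      have h2 := ih (y + Pi.single i (-1)) hy' (by omega)
      have h3 := hβ i (y + Pi.single i (-1)) hy'
      have e1 : (y + Pi.single i (-1) + ev i : Zd d) = y := by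
        rw [ev, add_assoc, ← Pi.single_add]; simp
      rw [e1] at h3
      push_cast
      rw [abs_sub_comm] at h3
      calc |g y - g z| = |(g y - g (y + Pi.single i (-1))) + (g (y + Pi.single i (-1)) - g z)| := by ring_nf
        _ ≤ _ := abs_add_le _ _
        _ ≤ _ := by linarith

theorem int_tail (hd : 3 ≤ d) {ρ t : ℝ} (hρ : 0 < ρ) (ht : ρ ^ 2 ≤ t) (w y : Zd d) :
    ∫ s in (ρ ^ 2)..t, (Kop s (dl w) : E d) y ≤ 2 * 4 ^ d * (ρ ^ 2 / ρ ^ d) := by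
  obtain ⟨m, rfl⟩ : ∃ m, d = m + 3 := ⟨d - 3, by omega⟩
  have hpos : ∀ s ∈ Set.uIcc (ρ ^ 2) t, 0 < s := by
    intro s hs
    rw [Set.uIcc_of_le ht] at hs
    exact lt_of_lt_of_le (by positivity) hs.1
  have hder : ∀ s ∈ Set.uIcc (ρ ^ 2) t, HasDerivAt (fun s => -2 * (√s)⁻¹) (1 / (√s) ^ 3) s := by
    intro s hs
    have hs0 := hpos s hs
    have h1 := ((Real.hasDerivAt_sqrt hs0.ne').inv (Real.sqrt_ne_zero'.2 hs0)).const_mul (-2)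
    refine HasDerivAt.congr_deriv h1 ?_
    have : √s ≠ 0 := Real.sqrt_ne_zero'.2 hs0
    field_simp
  have hcont : ContinuousOn (fun s : ℝ => 1 / (√s) ^ 3) (Set.uIcc (ρ ^ 2) t) := by
    refine ContinuousOn.div continuousOn_const (by fun_prop) fun s hs => ?_
    have : √s ≠ 0 := Real.sqrt_ne_zero'.2 (hpos s hs)
    positivity
  have hint := intervalIntegral.integral_eq_sub_of_hasDerivAt hder hcont.intervalIntegrable
  have hle := intervalIntegral.integral_mono_on (μ := MeasureTheory.volume) ht
    (f := fun s => (Kop s (dl w) : E (m + 3)) y) (g := fun s => (4 ^ (m + 3) / ρ ^ m) * (1 / (√s) ^ 3))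
    ((K_dl_cont w y).intervalIntegrable _ _) (hcont.intervalIntegrable.const_mul _) (by
      intro s hs
      have hs0 : 0 < s := lt_of_lt_of_le (by positivity) hs.1
      rw [K_dl hs0.le]
      refine (pk_upper hs0 _).trans ?_
      have hsq : ρ ≤ √s := by
        rw [← Real.sqrt_sq hρ.le]; exact Real.sqrt_le_sqrt hs.1
      have hsq0 : 0 < √s := lt_of_lt_of_le hρ hsq
      calc (4 / √s) ^ (m + 3) = 4 ^ (m + 3) / √s ^ m * (1 / √s ^ 3) := by
            rw [div_pow, pow_add (√s)]; field_simp
        _ ≤ _ := by gcongr)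
  rw [intervalIntegral.integral_const_mul, hint, Real.sqrt_sq hρ.le] at hle
  refine hle.trans ?_
  have : 0 ≤ (√t)⁻¹ := by positivity
  calc (4 ^ (m + 3) / ρ ^ m) * (-2 * (√t)⁻¹ - -2 * ρ⁻¹) ≤ (4 ^ (m + 3) / ρ ^ m) * (2 * ρ⁻¹) := by
        gcongr; linarith
    _ = _ := by rw [pow_add ρ]; field_simp

theorem own (d : ℕ) (hd : 3 ≤ d) : ∃ C > 0, ∃ r0 ≥ (1 : ℝ), ∀ ρ t : ℝ, r0 ≤ ρ → ρ ^ 2 ≤ t → ∀ w y : Zd d,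
    (∃ i, ρ ≤ |((w - y) i : ℝ)|) →
    ∫ s in (0 : ℝ)..t, (Kop s (dl w) : E d) y ≤ C * (ρ ^ 2 / ρ ^ d) := by
  obtain ⟨C5, hC5, s5, hs5, H5⟩ := pk_far d (by omega)
  refine ⟨C5 * 4 ^ d + 2 * 4 ^ d, by positivity, s5, hs5, ?_⟩
  intro ρ t hρ ht w y hw
  have hρ1 : 1 ≤ ρ := le_trans hs5 hρ
  have hρ0 : 0 < ρ := by linarith
  have h1 : ∫ s in (0 : ℝ)..(ρ ^ 2), (Kop s (dl w) : E d) y ≤ C5 * (4 / ρ) ^ d * (ρ ^ 2 - 0) := by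
    refine int_le le_rfl (by positivity) w y fun s hs1 hs2 => ?_
    refine (H5 s (ρ ^ 2) hs1 hs2 (by nlinarith) _ ?_).trans ?_
    · rw [Real.sqrt_sq hρ0.le]; exact hw
    · refine mul_le_mul_of_nonneg_left ((pk_upper (by positivity) _).trans ?_) hC5.le
      have : ρ ≤ √(2 * ρ ^ 2) := Real.le_sqrt_of_sq_le (by nlinarith)
      gcongr
  have h2 := int_tail hd hρ0 ht w y
  rw [← intervalIntegral.integral_add_adjacent_intervals (b := ρ ^ 2)
    ((K_dl_cont w y).intervalIntegrable _ _) ((K_dl_cont w y).intervalIntegrable _ _)]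
  have h3 : C5 * (4 / ρ) ^ d * (ρ ^ 2 - 0) = C5 * 4 ^ d * (ρ ^ 2 / ρ ^ d) := by
    rw [div_pow, sub_zero]; ring
  rw [add_mul]
  linarith


set_option maxHeartbeats 1000000 in
theorem main_prop (d : ℕ) (hd : 3 ≤ d) (δ : ℝ) (hδ : 0 < δ) (hδ1 : δ < 1) : ∃ M : ℕ, 8 ≤ M ∧ ∃ K0 : ℕ, M ≤ K0 ∧
    ∀ (L K : ℕ) (Z D0 : Finset (Zd d)) (h : E d) (e : Zd d → ℝ), Cfg d L K Z D0 h e → K0 ≤ K →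
    ∀ z ∈ Z, ∃ F : ℝ, 0 ≤ F ∧ ∀ y : Zd d, (∀ i, |y i - z i| ≤ (M * L : ℤ)) →
      (∃ i, |y i - z i| = (M * L : ℤ)) → (1 - δ) * F ≤ h y ∧ h y ≤ (1 + δ) * F := by
  obtain ⟨CA, hCA, TA, HA⟩ := stepA d
  obtain ⟨CB, hCB, TB, HB⟩ := stepB d hd
  obtain ⟨Tb, Hb⟩ := boot d hd
  obtain ⟨C1, hC1, s1, hs1, H1⟩ := K_cmp d
  obtain ⟨C2, hC2, s2, hs2, H2⟩ := pk_cmp d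
  obtain ⟨C3, hC3, s3, hs3, H3⟩ := K_grad d
  obtain ⟨C5, hC5, s5, hs5, H5⟩ := pk_far d (by omega)
  obtain ⟨Co, hCo, r0, hr0, Ho⟩ := own d hd
  obtain ⟨r, hr⟩ := exists_nat_ge (max 4 (max r0 (3 * (Co * CA) / δ)))
  have hr4 : (4 : ℝ) ≤ r := le_trans (le_max_left _ _) hr
  have hrr0 : r0 ≤ r := le_trans ((le_max_left _ _).trans (le_max_right _ _)) hr
  have hrC : 3 * (Co * CA) / δ ≤ r := le_trans ((le_max_right _ _).trans (le_max_right _ _)) hr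
  set M : ℕ := r + 4 with hM
  have hM8 : 8 ≤ M := by
    have : 4 ≤ r := by exact_mod_cast hr4
    omega
  set G1 : ℝ := 8 * C1 * C3 * d * M with hG1
  have hG10 : 0 ≤ G1 := by positivity
  set G2 : ℝ := C5 * C2 * CB * 512 * 2 with hG2
  have hG20 : 0 < G2 := by positivity
  obtain ⟨T1, hT1⟩ := exists_nat_ge (max (3 * G1 / δ) (max (3 * G2 / δ) (max s1 (max s2 (max s3 s5)))))
  set T : ℕ := T1 + TA + TB + Tb + M with hT
  refine ⟨M, hM8, 2 * T, by omega, ?_⟩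
  intro L K Z D0 h e cf hK z hz
  have hTT1 : (T1 : ℝ) ≤ T := by exact_mod_cast (show T1 ≤ T by omega)
  have hTmax := hT1.trans hTT1
  simp only [max_le_iff] at hTmax
  obtain ⟨hTG1, hTG2, hTs1, hTs2, hTs3, hTs5⟩ := hTmax
  have hTM : (M : ℝ) ≤ T := by exact_mod_cast (show M ≤ T by omega)
  have hM8' : (8 : ℝ) ≤ M := by exact_mod_cast hM8
  have hT0 : (0 : ℝ) < T := by linarith
  have hL : (1 : ℝ) ≤ L := by exact_mod_cast cf.hL
  set N : ℝ := (T : ℝ) * L with hN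
  have hN1 : (T : ℝ) ≤ N := by rw [hN]; nlinarith
  have hN0 : 0 < N := by linarith
  set t : ℝ := N ^ 2 with ht
  have htT : (T : ℝ) ≤ t := by rw [ht]; nlinarith
  have ht0 : 0 < t := by positivity
  have hst : √t = N := Real.sqrt_sq hN0.le
  have hMN : (M : ℝ) * L ≤ N := by rw [hN]; gcongr
  have hg1 : G1 / T ≤ δ / 3 := by
    rw [div_le_iff₀ hδ] at hTG1
    rw [div_le_div_iff₀ hT0 (by norm_num)]; linarith
  have hg2 : G2 / T ≤ δ / 3 := by
    rw [div_le_iff₀ hδ] at hTG2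
    rw [div_le_div_iff₀ hT0 (by norm_num)]; linarith
  have hr00 : (0 : ℝ) < r := by linarith
  have hg3 : Co * CA / r ≤ δ / 3 := by
    rw [div_le_iff₀ hδ] at hrC
    rw [div_le_div_iff₀ hr00 (by norm_num)]; linarith
  have HBc : ∀ y, t * ∑ z ∈ Z, ∑ v ∈ D0, e (z + v) * pk (4 * t) (z + v - y) ≤ CB / T * Kop (10 * t) h y :=
    HB T L K Z D0 h e cf (by omega) (by omega)
  have Hbc : ∀ (j : ℕ) y, Kop (((j : ℝ) + 1) * t) h y ≤ 2 ^ j * Kop t h y :=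
    Hb T L K Z D0 h e cf (by omega) (by omega)
  have HAc : (L : ℝ) ^ 2 * ∑ v ∈ D0, e (z + v) ≤ CA * (L : ℝ) ^ d * Kop t h z :=
    HA T L K Z D0 h e cf (by omega) z hz
  set F := Kop t h z with hF
  have hF0 : 0 ≤ F := cf.nonneg ht0.le z
  refine ⟨F, hF0, ?_⟩
  intro y hy hys
  have hstep : ∀ i v, (∀ j, |v j - z j| ≤ (M * L : ℤ)) →
      |Kop t h v - Kop t h (v + ev i)| ≤ 8 * C1 * C3 / N * F := by
    intro i v hv
    have h1 := H3 t (by linarith) h cf.h0 i v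
    rw [hst] at h1
    have h2 := H1 (2 * t) (2 * t) (by linarith) le_rfl (by linarith) (by linarith) (z - v) (by
      intro j
      have h3 : (((|v j - z j| : ℤ)) : ℝ) ≤ ((M * L : ℤ) : ℝ) := by exact_mod_cast hv j
      push_cast at h3
      rw [abs_sub_comm] at h3
      rw [Pi.sub_apply, Int.cast_sub]
      refine h3.trans (hMN.trans ?_)
      rw [← hst]
      exact Real.sqrt_le_sqrt (by linarith)) h cf.h0 v
    rw [add_sub_cancel, show 2 * (2 * t) = (((3 : ℕ) : ℝ) + 1) * t by push_cast; ring] at h2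
    have h3 := Hbc 3 z
    calc _ ≤ C3 / N * Kop (2 * t) h v := h1
      _ ≤ C3 / N * (C1 * (2 ^ 3 * F)) := by
          gcongr
          exact h2.trans (by gcongr)
      _ = _ := by ring
  have hpath := path (fun v => Kop t h v) z (M * L) _ hstep _ y hy rfl
  have hsum : ((∑ i, (y i - z i).natAbs : ℕ) : ℝ) ≤ d * (M * L) := by
    push_cast
    calc _ ≤ ∑ i : Fin d, ((M : ℝ) * L) := by
          refine Finset.sum_le_sum fun i _ => ?_
          have := hy i
          rw [Nat.cast_natAbs]
          exact_mod_cast this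
      _ = _ := by simp
  have hclose : |Kop t h y - F| ≤ δ / 3 * F := by
    refine hpath.trans ?_
    calc _ ≤ 8 * C1 * C3 / N * F * (d * (M * L)) := by gcongr
      _ = G1 / T * F := by rw [hG1, hN]; field_simp
      _ ≤ _ := by gcongr
  rw [abs_le] at hclose
  have hmono : h y ≤ Kop t h y := by
    have := cf.mono (le_refl (0 : ℝ)) ht0.le y
    rwa [Kop_zero] at this
  refine ⟨?_, by nlinarith⟩
  have hint := cf.int 0 t y
  rw [Kop_zero] at hint
  rw [← Finset.add_sum_erase Z _ hz] at hint
  set ρ : ℝ := (r : ℝ) * L with hρ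
  have hρ0 : 0 < ρ := by positivity
  have hown : ∑ v ∈ D0, e (z + v) * ∫ s in (0 : ℝ)..t, (Kop s (dl (z + v)) : E d) y ≤ δ / 3 * F := by
    calc _ ≤ ∑ v ∈ D0, e (z + v) * (Co * (ρ ^ 2 / ρ ^ d)) := by
          refine Finset.sum_le_sum fun v hv => mul_le_mul_of_nonneg_left ?_ (cf.e0 _)
          refine Ho ρ t (hrr0.trans ?_) ?_ _ _ ?_
          · rw [hρ]; nlinarith
          · rw [ht]
            have : (r : ℝ) ≤ M := by rw [hM]; push_cast; linarith
            have : ρ ≤ N := by rw [hρ]; exact le_trans (by gcongr) hMN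
            gcongr
          · obtain ⟨i, hi⟩ := hys
            refine ⟨i, ?_⟩
            have h1 := cf.hD v hv i
            have h2 : (r : ℤ) * L ≤ |(z + v - y) i| := by
              simp only [Pi.sub_apply, Pi.add_apply]
              have h3 : (M : ℤ) * L = r * L + 4 * L := by rw [hM]; push_cast; ring
              have h4 := abs_sub_abs_le_abs_sub (z i - y i) (-v i)
              rw [abs_neg, sub_neg_eq_add, abs_sub_comm (z i)] at h4
              rw [show z i + v i - y i = z i - y i + v i by ring]
              linarith
            rw [hρ]
            exact_mod_cast h2
      _ = (∑ v ∈ D0, e (z + v)) * (Co * (ρ ^ 2 / ρ ^ d)) := by rw [Finset.sum_mul]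
      _ = Co * r ^ 2 / (r ^ d * L ^ d) * ((L : ℝ) ^ 2 * ∑ v ∈ D0, e (z + v)) := by
          rw [hρ, mul_pow, mul_pow]; ring
      _ ≤ Co * r ^ 2 / (r ^ d * L ^ d) * (CA * (L : ℝ) ^ d * F) := by gcongr
      _ = Co * CA * F * (r ^ 2 / r ^ d) := by field_simp
      _ ≤ Co * CA * F * (1 / r) := by
          refine mul_le_mul_of_nonneg_left ?_ (by positivity)
          rw [div_le_div_iff₀ (by positivity) hr00, one_mul, ← pow_succ]
          exact pow_le_pow_right₀ (by linarith) hd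
      _ = Co * CA / r * F := by ring
      _ ≤ _ := by gcongr
  have hoth : ∑ z' ∈ Z.erase z, ∑ v ∈ D0, e (z' + v) * ∫ s in (0 : ℝ)..t, (Kop s (dl (z' + v)) : E d) y
      ≤ δ / 3 * F := by
    have hf2 : Kop t h y ≤ 2 * F := by nlinarith
    have hb9 := Hbc 9 y
    rw [show (((9 : ℕ) : ℝ) + 1) * t = 10 * t by push_cast; ring] at hb9
    calc _ ≤ ∑ z' ∈ Z.erase z, ∑ v ∈ D0, C5 * C2 * (t * (e (z' + v) * pk (4 * t) (z' + v - y))) := by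
          refine Finset.sum_le_sum fun z' hz' => Finset.sum_le_sum fun v hv => ?_
          rw [Finset.mem_erase] at hz'
          have : ∫ s in (0 : ℝ)..t, (Kop s (dl (z' + v)) : E d) y ≤
              C5 * (C2 * pk (4 * t) (z' + v - y)) * (t - 0) := by
            refine int_le le_rfl ht0.le _ _ fun s hs1 hs2 => ?_
            have q1 := H2 (2 * t) (2 * t) (by linarith) le_rfl (by linarith) (by linarith) 0
              (by intro i; simp) (z' + v - y)
            rw [add_zero, show 2 * (2 * t) = 4 * t by ring] at q1
            refine (H5 s t hs1 hs2 (by linarith) _ ?_).trans (mul_le_mul_of_nonneg_left q1 hC5.le)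
            obtain ⟨i, hi⟩ := cf.sep z' hz'.2 z hz hz'.1
            refine ⟨i, ?_⟩
            rw [hst, hN]
            have h1 := cf.hD v hv i
            have h2 := hy i
            have h3 : (T : ℤ) * L ≤ |(z' + v - y) i| := by
              simp only [Pi.sub_apply, Pi.add_apply]
              have k1 : (2 * T : ℤ) ≤ K := by exact_mod_cast hK
              have k2 : (M : ℤ) ≤ T := by exact_mod_cast (show M ≤ T by omega)
              have k3 : (8 : ℤ) ≤ M := by exact_mod_cast hM8
              have k4 : ((T : ℤ) + M + 4) * L ≤ (2 * K + 3) * L := by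
                refine mul_le_mul_of_nonneg_right (by linarith) (by positivity)
              have k5 : |z' i - z i| ≤ |z' i + v i - y i| + |v i| + |y i - z i| := by
                calc |z' i - z i| = |(z' i + v i - y i) - v i + (y i - z i)| := by ring_nf
                  _ ≤ _ := (abs_add_le _ _).trans (add_le_add_left (abs_sub _ _) _)
              linarith
            exact_mod_cast h3
          calc _ ≤ e (z' + v) * (C5 * (C2 * pk (4 * t) (z' + v - y)) * (t - 0)) :=
                mul_le_mul_of_nonneg_left this (cf.e0 _)
            _ = _ := by ring
      _ ≤ ∑ z' ∈ Z, ∑ v ∈ D0, C5 * C2 * (t * (e (z' + v) * pk (4 * t) (z' + v - y))) := by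
          refine Finset.sum_le_sum_of_subset_of_nonneg (Finset.erase_subset _ _) fun z' _ _ =>
            Finset.sum_nonneg fun v _ => ?_
          have q1 := cf.e0 (z' + v)
          have q2 : 0 ≤ pk (4 * t) (z' + v - y) := pk_nonneg (by positivity) _
          positivity
      _ = C5 * C2 * (t * ∑ z' ∈ Z, ∑ v ∈ D0, e (z' + v) * pk (4 * t) (z' + v - y)) := by
          simp only [Finset.mul_sum]
      _ ≤ C5 * C2 * (CB / T * Kop (10 * t) h y) := mul_le_mul_of_nonneg_left (HBc y) (by positivity)
      _ ≤ C5 * C2 * (CB / T * (2 ^ 9 * (2 * F))) := by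
          gcongr
          exact hb9.trans (by gcongr)
      _ = G2 / T * F := by rw [hG2]; ring
      _ ≤ _ := by gcongr
  linarith

end Aux11

namespace Aux11

theorem expM_Ioi (c : ℝ) (hc : 0 ≤ c) : expMeasure (Set.Ioi c) = ENNReal.ofReal (Real.exp (-c)) := by
  rw [expMeasure, withDensity_apply _ measurableSet_Ioi, ← integral_exp_neg_Ioi c,
    ofReal_integral_eq_lintegral_ofReal (integrableOn_exp_neg_Ioi c) (Filter.Eventually.of_forall fun x => (Real.exp_pos _).le)]
  refine setLIntegral_congr_fun measurableSet_Ioi fun t ht => ?_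
  rw [if_pos (lt_of_le_of_lt hc ht)]

theorem expM_Iic0 : expMeasure (Set.Iic 0) = 0 := by
  rw [expMeasure, withDensity_apply _ measurableSet_Iic, setLIntegral_congr_fun (g := fun _ => 0) measurableSet_Iic]
  · simp
  · intro t ht
    simp [not_lt.2 (show t ≤ 0 from ht)]

theorem expM_univ : expMeasure Set.univ = 1 := by
  rw [← Set.Iic_union_Ioi (a := (0 : ℝ)), measure_union (Set.Iic_disjoint_Ioi le_rfl) measurableSet_Ioi,
    expM_Iic0, expM_Ioi 0 le_rfl]
  simp

theorem expM_Iic1 : expMeasure (Set.Iic 1) < 1 := by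
  have h1 := expM_univ
  rw [← Set.Iic_union_Ioi (a := (1 : ℝ)), measure_union (Set.Iic_disjoint_Ioi le_rfl) measurableSet_Ioi,
    expM_Ioi 1 zero_le_one] at h1
  rw [← h1]
  refine ENNReal.lt_add_right ?_ ?_
  · intro h
    rw [h] at h1
    simp at h1
  · simp [Real.exp_pos]

variable {d : ℕ} {Ω : Type*} [MeasurableSpace Ω] (W : SRW d Ω)

theorem cyl (x : Zd d) (n : ℕ) (S : Set (Fin n → Zd d)) (I : Fin n → Set ℝ) (hI : ∀ i, MeasurableSet (I i)) :
    W.P x {ω | (fun i : Fin n => W.Y ((i : ℕ) + 1) ω - W.Y (i : ℕ) ω) ∈ S ∧ ∀ i : Fin n, W.ζ (i : ℕ) ω ∈ I i}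
      = (∑' s : Fin n → Zd d, if s ∈ S then ∏ i, stepP d (s i) else 0) * ∏ i, expMeasure (I i) := by
  set g : Ω → (Fin n → Zd d) := fun ω i => W.Y ((i : ℕ) + 1) ω - W.Y (i : ℕ) ω with hg
  have hgm : Measurable g := by
    refine measurable_pi_lambda _ fun i => ?_
    exact (W.measurable_Y _).sub (W.measurable_Y _)
  set B : Set Ω := {ω | ∀ i : Fin n, W.ζ (i : ℕ) ω ∈ I i} with hB
  have hBm : MeasurableSet B := by
    rw [hB, Set.ofPred_forall]
    exact MeasurableSet.iInter fun i => W.measurable_ζ _ (hI i)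
  have key : ∀ S : Set (Fin n → Zd d), Measure.map g ((W.P x).restrict B) S = W.P x (g ⁻¹' S ∩ B) := by
    intro S
    have hS : MeasurableSet S := S.to_countable.measurableSet
    rw [Measure.map_apply hgm hS, Measure.restrict_apply (hgm hS)]
  have h1 := Measure.tsum_indicator_apply_singleton (Measure.map g ((W.P x).restrict B)) S
    S.to_countable.measurableSet
  rw [key] at h1
  have h2 : {ω | g ω ∈ S ∧ ∀ i : Fin n, W.ζ (i : ℕ) ω ∈ I i} = g ⁻¹' S ∩ B := rfl
  rw [h2, ← h1, ← ENNReal.tsum_mul_right]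
  refine tsum_congr fun s => ?_
  rw [Set.indicator_apply]
  split_ifs with hs
  · rw [key, ← W.law x n s I hI]
    congr 1
    ext ω
    simp only [Set.mem_inter_iff, Set.mem_preimage, Set.mem_singleton_iff, Set.mem_ofPred_eq, hB, hg, funext_iff]
  · simp

theorem cylY (x : Zd d) (n : ℕ) (S : Set (Fin n → Zd d)) :
    W.P x {ω | (fun i : Fin n => W.Y ((i : ℕ) + 1) ω - W.Y (i : ℕ) ω) ∈ S}
      = ∑' s : Fin n → Zd d, if s ∈ S then ∏ i, stepP d (s i) else 0 := by
  have := cyl W x n S (fun _ => Set.univ) (fun _ => MeasurableSet.univ)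
  simpa [expM_univ] using this

theorem cylZ (x : Zd d) (n : ℕ) (I : Fin n → Set ℝ) (hI : ∀ i, MeasurableSet (I i)) :
    W.P x {ω | ∀ i : Fin n, W.ζ (i : ℕ) ω ∈ I i} = ∏ i, expMeasure (I i) := by
  have h1 := cyl W x n Set.univ I hI
  have h2 := cylY W x n Set.univ
  have := W.isProb x
  simp only [Set.mem_univ, true_and, Set.ofPred_true, measure_univ] at h1 h2
  rw [h1, ← h2, one_mul]

theorem ae_pos (x : Zd d) : ∀ᵐ ω ∂(W.P x), ∀ i, 0 < W.ζ i ω := by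
  rw [ae_all_iff]
  intro i
  rw [ae_iff]
  have h1 := cylZ W x (i + 1) (fun j => if (j : ℕ) = i then Set.Iic 0 else Set.univ)
    (fun j => by split_ifs <;> measurability)
  rw [Finset.prod_eq_zero (Finset.mem_univ (Fin.last i)) (by simp [expM_Iic0])] at h1
  refine measure_mono_null ?_ h1
  intro ω hω j
  split_ifs with hj
  · rw [hj]
    simpa using hω
  · trivial

theorem ae_large (x : Zd d) : ∀ᵐ ω ∂(W.P x), ∀ n, ∃ i, n ≤ i ∧ 1 < W.ζ i ω := by
  rw [ae_all_iff]
  intro n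
  rw [ae_iff]
  have hb : ∀ m : ℕ, W.P x {ω | ¬ ∃ i, n ≤ i ∧ 1 < W.ζ i ω} ≤ (expMeasure (Set.Iic 1)) ^ m := by
    intro m
    have h1 := cylZ W x (n + m) (fun j => if (j : ℕ) < n then Set.univ else Set.Iic 1)
      (fun j => by split_ifs <;> measurability)
    rw [Fin.prod_univ_add] at h1
    simp only [Fin.val_castAdd, Fin.is_lt, if_true, expM_univ, Finset.prod_const_one, one_mul,
      Fin.val_natAdd, show ∀ j : ℕ, ¬ (n + j < n) from fun j => by omega, if_false, Finset.prod_const,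
      Finset.card_univ, Fintype.card_fin] at h1
    rw [← h1]
    refine measure_mono ?_
    intro ω hω j
    split_ifs with hj
    · trivial
    · by_contra hc
      exact hω ⟨j, by omega, by simpa using hc⟩
  have ht := ENNReal.tendsto_pow_atTop_nhds_zero_of_lt_one expM_Iic1
  exact le_antisymm (ge_of_tendsto' ht hb) zero_le

theorem hit_iff (A : Set (Zd d)) (ω : Ω) (h1 : ∀ i, 0 < W.ζ i ω) (h2 : ∀ n, ∃ i, n ≤ i ∧ 1 < W.ζ i ω) :
    W.hitTilde A ω = ⊤ ↔ ∀ n, W.Y (n + 1) ω ∉ A := by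
  have hmono : StrictMono (fun n => W.S n ω) := strictMono_nat_of_lt_succ fun n => by
    simp only [SRW.S, Finset.sum_range_succ]; linarith [h1 n]
  have hunb : ∀ m : ℕ, ∃ n, (m : ℝ) ≤ W.S n ω := by
    intro m
    induction m with
    | zero => exact ⟨0, by simp [SRW.S]⟩
    | succ m ih =>
      obtain ⟨n, hn⟩ := ih
      obtain ⟨i, hi, hi1⟩ := h2 n
      refine ⟨i + 1, ?_⟩
      have := hmono.monotone hi
      simp only [SRW.S, Finset.sum_range_succ] at this hn ⊢
      push_cast
      linarith
  have hbdd : ∀ t : ℝ, BddAbove {k : ℕ | W.S k ω ≤ t} := by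
    intro t
    obtain ⟨m, hm⟩ := exists_nat_gt t
    obtain ⟨n, hn⟩ := hunb m
    refine ⟨n, fun k hk => ?_⟩
    have hk : W.S k ω ≤ t := hk
    by_contra hc
    have := hmono.monotone (le_of_not_ge hc)
    linarith
  have hS1 : W.S 1 ω = W.ζ 0 ω := by simp [SRW.S]
  have hS0 : ∀ n, 0 ≤ W.S n ω := fun n => Finset.sum_nonneg fun i _ => (h1 i).le
  constructor
  · intro hT n hn
    rw [SRW.hitTilde, SRW.hitFrom, sInf_eq_top] at hT
    obtain ⟨σ, hσ⟩ : ∃ σ : ℝ≥0, (σ : ℝ) = W.S (n + 1) ω := ⟨Real.toNNReal (W.S (n + 1) ω), Real.coe_toNNReal _ (hS0 _)⟩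
    have := hT (σ : ℝ≥0∞) ⟨σ, rfl, by
      rw [← hS1]
      rw [ENNReal.ofReal, ENNReal.coe_le_coe]
      refine Real.toNNReal_le_iff_le_coe.2 ?_
      rw [hσ]
      exact hmono.monotone (by omega), by
      rw [hσ]
      have : W.jumpIdx (W.S (n + 1) ω) ω = n + 1 := by
        refine le_antisymm (csSup_le ⟨n + 1, le_refl (W.S (n + 1) ω)⟩ fun k hk => ?_) (le_csSup (hbdd _) (le_refl (W.S (n + 1) ω)))
        exact hmono.le_iff_le.1 hk
      show W.Y (W.jumpIdx (W.S (n + 1) ω) ω) ω ∈ A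
      rw [this]
      exact hn⟩
    exact ENNReal.coe_ne_top this
  · intro hn
    rw [SRW.hitTilde, SRW.hitFrom, sInf_eq_top]
    rintro u ⟨s, rfl, hs, hX⟩
    exfalso
    have h3 : W.ζ 0 ω ≤ s := by
      rw [ENNReal.ofReal, ENNReal.coe_le_coe] at hs
      exact Real.toNNReal_le_iff_le_coe.1 hs
    have h4 : 1 ≤ W.jumpIdx (s : ℝ) ω := le_csSup (hbdd _) (show W.S 1 ω ≤ s by rw [hS1]; exact h3)
    have h5 := hn (W.jumpIdx (s : ℝ) ω - 1)
    rw [Nat.sub_add_cancel h4] at h5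
    exact h5 hX

theorem hit_ae (A : Set (Zd d)) (x : Zd d) :
    W.P x {ω | W.hitTilde A ω = ⊤} = W.P x {ω | ∀ n, W.Y (n + 1) ω ∉ A} := by
  refine measure_congr ?_
  filter_upwards [ae_pos W x, ae_large W x] with ω h1 h2
  exact propext (hit_iff W A ω h1 h2)

end Aux11

namespace Aux11

def Av {d : ℕ} (A : Set (Zd d)) : (n : ℕ) → Zd d → (Fin n → Zd d) → Prop
  | 0, x, _ => x ∉ A
  | n + 1, x, s => x ∉ A ∧ Av A n (x + s 0) (fun i => s i.succ)

theorem Av_iff {d : ℕ} (A : Set (Zd d)) (n : ℕ) : ∀ f : ℕ → Zd d,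
    Av A n (f 0) (fun i : Fin n => f ((i : ℕ) + 1) - f (i : ℕ)) ↔ ∀ k ≤ n, f k ∉ A := by
  induction n with
  | zero =>
    intro f
    simp [Av]
  | succ n ih =>
    intro f
    have := ih (fun k => f (k + 1))
    simp only [Av, Fin.val_succ, Fin.val_zero, zero_add, add_sub_cancel]
    simp only [zero_add] at this
    rw [this]
    constructor
    · rintro ⟨h1, h2⟩ k hk
      cases k with
      | zero => exact h1
      | succ k => exact h2 k (by omega)
    · intro h
      exact ⟨h 0 (by omega), fun k hk => h (k + 1) (by omega)⟩

variable {d : ℕ} {Ω : Type*} [MeasurableSpace Ω] (W : SRW d Ω)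

theorem ae_start (x : Zd d) : ∀ᵐ ω ∂(W.P x), W.Y 0 ω = x := by
  have := W.isProb x
  exact (prob_compl_eq_zero_iff (W.measurable_Y 0 (measurableSet_singleton x))).2 (W.Y_zero x)

noncomputable def qn (A : Set (Zd d)) (n : ℕ) (x : Zd d) : ℝ≥0∞ :=
  ∑' s : Fin n → Zd d, if Av A n x s then ∏ i, stepP d (s i) else 0

theorem P_qn (A : Set (Zd d)) (n : ℕ) (x : Zd d) : W.P x {ω | ∀ k ≤ n, W.Y k ω ∉ A} = qn A n x := by
  have h1 := cylY W x n {s | Av A n x s}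
  simp only [Set.mem_ofPred_eq] at h1
  rw [qn, ← h1]
  refine measure_congr ?_
  filter_upwards [ae_start W x] with ω h
  refine propext ?_
  have := Av_iff A n (fun k => W.Y k ω)
  simp only [h] at this
  exact this.symm

theorem P_qn' (A : Set (Zd d)) (n : ℕ) (x : Zd d) :
    W.P x {ω | ∀ k ≤ n, W.Y (k + 1) ω ∉ A} = ∑' v, stepP d v * qn A n (x + v) := by
  have h1 := cylY W x (n + 1) {s | Av A n (x + s 0) (fun i => s i.succ)}
  simp only [Set.mem_ofPred_eq] at h1
  have h2 : W.P x {ω | ∀ k ≤ n, W.Y (k + 1) ω ∉ A} =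
      ∑' s : Fin (n + 1) → Zd d, if Av A n (x + s 0) (fun i => s i.succ) then ∏ i, stepP d (s i) else 0 := by
    rw [← h1]
    refine measure_congr ?_
    filter_upwards [ae_start W x] with ω h
    refine propext ?_
    have := Av_iff A n (fun k => W.Y (k + 1) ω)
    simp only [zero_add] at this
    refine this.symm.trans ?_
    show _ ↔ Av A n _ _
    simp only [Fin.val_zero, zero_add, h, add_sub_cancel, Fin.val_succ]
  rw [h2, ← (Fin.consEquiv (fun _ : Fin (n + 1) => Zd d)).tsum_eq, ENNReal.tsum_prod']
  refine tsum_congr fun v => ?_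
  rw [qn, ← ENNReal.tsum_mul_left]
  refine tsum_congr fun s => ?_
  simp only [Fin.consEquiv_apply, Fin.cons_zero, Fin.cons_succ, Fin.prod_univ_succ, mul_ite, mul_zero]

noncomputable def nb (p : Fin d × Bool) : Zd d := if p.2 then ev p.1 else -ev p.1

theorem nb_inj : Function.Injective (nb (d := d)) := by
  rintro ⟨i, b⟩ ⟨j, c⟩ h
  have h1 := congrFun h i
  have h2 := congrFun h j
  by_cases hij : i = j
  · subst hij
    cases b <;> cases c <;> simp [nb, ev] at h1 ⊢
  · cases b <;> cases c <;> simp [nb, ev, Pi.single_apply, hij, Ne.symm hij] at h1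

theorem stepP_nb (p : Fin d × Bool) : stepP d (nb p) = ((2 * d : ℕ) : ℝ≥0∞)⁻¹ := by
  rw [stepP, if_pos]
  rw [Finset.sum_eq_single p.1]
  · rcases p with ⟨i, b⟩
    cases b <;> simp [nb, ev]
  · intro j _ hj
    rcases p with ⟨i, b⟩
    cases b <;> simp [nb, ev, Pi.single_apply, hj]
  · simp

theorem stepP_supp (v : Zd d) (hv : stepP d v ≠ 0) : ∃ p, nb p = v := by
  rw [stepP] at hv
  have h1 : ∑ i, (v i).natAbs = 1 := by
    by_contra hc
    rw [if_neg hc] at hv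
    exact hv rfl
  have : ∃ i, v i ≠ 0 := by
    by_contra hcon
    push Not at hcon
    simp [hcon] at h1
  obtain ⟨i, hi⟩ := this
  rw [← Finset.add_sum_erase Finset.univ _ (Finset.mem_univ i)] at h1
  have h2 : ∑ x ∈ Finset.univ.erase i, (v x).natAbs = 0 := by omega
  rw [Finset.sum_eq_zero_iff] at h2
  have h3 : v i = 1 ∨ v i = -1 := by omega
  have h4 : ∀ j, j ≠ i → v j = 0 := fun j hj => by
    have := h2 j (Finset.mem_erase.2 ⟨hj, Finset.mem_univ _⟩)
    omega
  rcases h3 with h3 | h3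
  · refine ⟨(i, true), ?_⟩
    funext j
    by_cases hj : j = i
    · subst hj; simp [nb, ev, h3]
    · simp [nb, ev, Pi.single_apply, hj, h4 j hj]
  · refine ⟨(i, false), ?_⟩
    funext j
    by_cases hj : j = i
    · subst hj; simp [nb, ev, h3]
    · simp [nb, ev, Pi.single_apply, hj, h4 j hj]

theorem step_sum (f : Zd d → ℝ≥0∞) :
    ∑' v, stepP d v * f v = ∑ p : Fin d × Bool, ((2 * d : ℕ) : ℝ≥0∞)⁻¹ * f (nb p) := by
  rw [← nb_inj.tsum_eq, tsum_fintype]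
  · simp only [stepP_nb]
  · intro v hv
    exact stepP_supp v (left_ne_zero_of_mul hv)

noncomputable def Hm (A : Set (Zd d)) (x : Zd d) : ℝ≥0∞ := W.P x {ω | ∀ n, W.Y n ω ∉ A}

theorem tend_aux (x : Zd d) (f : ℕ → Ω → Zd d) (hf : ∀ n, Measurable (f n)) (A : Set (Zd d)) :
    Filter.Tendsto (fun n : ℕ => W.P x {ω | ∀ k ≤ n, f k ω ∉ A}) Filter.atTop
      (nhds (W.P x {ω | ∀ n, f n ω ∉ A})) := by
  have := W.isProb x
  have h1 : {ω | ∀ n, f n ω ∉ A} = ⋂ n : ℕ, {ω | ∀ k ≤ n, f k ω ∉ A} := by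
    ext ω
    simp only [Set.mem_iInter, Set.mem_ofPred_eq]
    exact ⟨fun h n k _ => h k, fun h n => h n n le_rfl⟩
  rw [h1]
  refine tendsto_measure_iInter_atTop (fun n => ?_) ?_ ⟨0, measure_ne_top _ _⟩
  · refine MeasurableSet.nullMeasurableSet ?_
    simp only [Set.ofPred_forall]
    exact MeasurableSet.iInter fun k => MeasurableSet.iInter fun _ => hf k (A.to_countable.measurableSet.compl)
  · intro m n hmn ω hω k hk
    exact hω k (hk.trans hmn)

theorem P_step (hd : 1 ≤ d) (A : Set (Zd d)) (x : Zd d) :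
    W.P x {ω | ∀ n, W.Y (n + 1) ω ∉ A} = ∑ p : Fin d × Bool, ((2 * d : ℕ) : ℝ≥0∞)⁻¹ * Hm W A (x + nb p) := by
  have h1 := tend_aux W x (fun n => W.Y (n + 1)) (fun n => W.measurable_Y _) A
  simp only [P_qn', step_sum] at h1
  refine tendsto_nhds_unique h1 ?_
  refine tendsto_finsetSum _ fun p _ => ENNReal.Tendsto.const_mul ?_ (Or.inr ?_)
  · have := tend_aux W (x + nb p) W.Y W.measurable_Y A
    simp only [P_qn] at this
    exact this
  · simp; omega

theorem Hm_le (A : Set (Zd d)) (x : Zd d) : Hm W A x ≤ 1 := by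
  have := W.isProb x
  exact prob_le_one

noncomputable def hR (A : Set (Zd d)) (x : Zd d) : ℝ := (Hm W A x).toReal

theorem hR_nonneg (A : Set (Zd d)) (x : Zd d) : 0 ≤ hR W A x := ENNReal.toReal_nonneg

theorem hR_le (A : Set (Zd d)) (x : Zd d) : hR W A x ≤ 1 := by
  have := ENNReal.toReal_mono (by simp) (Hm_le W A x)
  simpa [hR] using this

theorem hR_in (A : Set (Zd d)) (x : Zd d) (hx : x ∈ A) : hR W A x = 0 := by
  rw [hR, Hm, ENNReal.toReal_eq_zero_iff]
  left
  rw [measure_eq_zero_iff_ae_notMem]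
  filter_upwards [ae_start W x] with ω h hω
  exact hω 0 (by rw [h]; exact hx)

noncomputable def avg (f : Zd d → ℝ) (x : Zd d) : ℝ :=
  (2 * d : ℝ)⁻¹ * ∑ i : Fin d, (f (x + ev i) + f (x + -ev i))

theorem P_step_real (hd : 1 ≤ d) (A : Set (Zd d)) (x : Zd d) :
    (W.P x {ω | ∀ n, W.Y (n + 1) ω ∉ A}).toReal = avg (hR W A) x := by
  have hne : ((2 * d : ℕ) : ℝ≥0∞)⁻¹ ≠ ⊤ := by simp; omega
  rw [P_step W hd, ENNReal.toReal_sum (fun p _ => ENNReal.mul_ne_top hne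
    (lt_of_le_of_lt (Hm_le W A _) (by simp)).ne), Fintype.sum_prod_type, avg, Finset.mul_sum]
  refine Finset.sum_congr rfl fun i _ => ?_
  simp only [Fintype.sum_bool, ENNReal.toReal_mul, ENNReal.toReal_inv, nb, hR, ENNReal.toReal_natCast]
  simp
  ring

theorem eqm_in (hd : 1 ≤ d) (A : Set (Zd d)) (x : Zd d) (hx : x ∈ A) : W.eqm A x = avg (hR W A) x := by
  rw [SRW.eqm, if_pos hx, hit_ae, P_step_real W hd]

theorem hR_out (hd : 1 ≤ d) (A : Set (Zd d)) (x : Zd d) (hx : x ∉ A) : hR W A x = avg (hR W A) x := by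
  rw [← P_step_real W hd, hR, Hm]
  congr 1
  refine measure_congr ?_
  filter_upwards [ae_start W x] with ω h
  refine propext ⟨fun H n => H (n + 1), fun H n => ?_⟩
  cases n with
  | zero => rw [h]; exact hx
  | succ n => exact H n

end Aux11

namespace Aux11

variable {d : ℕ}

theorem avg_lin (a b : ℝ) (f g : Zd d → ℝ) (x : Zd d) :
    avg (fun y => a * f y + b * g y) x = a * avg f x + b * avg g x := by
  simp only [avg, Finset.mul_sum, ← Finset.sum_add_distrib]
  refine Finset.sum_congr rfl fun i _ => ?_
  ring

theorem nbr_ball {R : ℤ} {y z : Zd d} (hy : ∀ i, |y i - z i| < R) (i : Fin d) :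
    (∀ j, |(y + ev i : Zd d) j - z j| ≤ R) ∧ (∀ j, |(y + -ev i : Zd d) j - z j| ≤ R) := by
  constructor <;> intro j <;> have := hy j <;> rw [abs_lt] at this <;> rw [abs_le] <;>
    by_cases hj : j = i
  · subst hj
    simp only [ev, Pi.add_apply, Pi.single_eq_same]; omega
  · simp only [ev, Pi.add_apply, Pi.single_eq_of_ne hj]; omega
  · subst hj
    simp only [ev, Pi.add_apply, Pi.neg_apply, Pi.single_eq_same]; omega
  · simp only [ev, Pi.add_apply, Pi.neg_apply, Pi.single_eq_of_ne hj]; omega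

theorem avg_nonneg {R : ℤ} {y z : Zd d} (hy : ∀ i, |y i - z i| < R) (g : Zd d → ℝ)
    (hg : ∀ y, (∀ i, |y i - z i| ≤ R) → 0 ≤ g y) : 0 ≤ avg g y := by
  refine mul_nonneg (by positivity) (Finset.sum_nonneg fun i _ => ?_)
  have := nbr_ball hy i
  exact add_nonneg (hg _ this.1) (hg _ this.2)

theorem maxp (hd : 1 ≤ d) (g : Zd d → ℝ) (z : Zd d) (R : ℤ) (D : Set (Zd d))
    (h1 : ∀ y, (∀ i, |y i - z i| < R) → y ∉ D → g y = avg g y)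
    (h2 : ∀ y, y ∈ D → 0 ≤ g y)
    (h3 : ∀ y, (∀ i, |y i - z i| ≤ R) → (∃ i, |y i - z i| = R) → 0 ≤ g y) :
    ∀ y, (∀ i, |y i - z i| ≤ R) → 0 ≤ g y := by
  by_contra hcon
  push Not at hcon
  obtain ⟨y1, hy1, hy1n⟩ := hcon
  set B : Finset (Zd d) := Fintype.piFinset (fun i => Finset.Icc (z i - R) (z i + R)) with hB
  have hBm : ∀ y, y ∈ B ↔ ∀ i, |y i - z i| ≤ R := by
    intro y
    rw [hB, Fintype.mem_piFinset]
    refine forall_congr' fun i => ?_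
    rw [Finset.mem_Icc, abs_le]
    constructor <;> intro h <;> constructor <;> omega
  obtain ⟨y2, hy2, hmin⟩ := Finset.exists_min_image B g ⟨y1, (hBm y1).2 hy1⟩
  have hm : g y2 < 0 := lt_of_le_of_lt (hmin y1 ((hBm y1).2 hy1)) hy1n
  let i0 : Fin d := ⟨0, by omega⟩
  obtain ⟨y3, hy3, hmax⟩ := Finset.exists_max_image (B.filter (fun y => g y = g y2)) (fun y => y i0)
    ⟨y2, Finset.mem_filter.2 ⟨hy2, rfl⟩⟩
  rw [Finset.mem_filter] at hy3
  have hyb := (hBm y3).1 hy3.1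
  have hint : ∀ i, |y3 i - z i| < R := by
    intro i
    refine lt_of_le_of_ne (hyb i) fun h => ?_
    have := h3 y3 hyb ⟨i, h⟩
    linarith [hy3.2]
  have hD : y3 ∉ D := fun h => by linarith [h2 y3 h, hy3.2]
  have heq := h1 y3 hint hD
  have hlt : g y2 < g (y3 + ev i0) := by
    have hb := (nbr_ball hint i0).1
    refine lt_of_le_of_ne (hmin _ ((hBm _).2 hb)) fun h => ?_
    have := hmax (y3 + ev i0) (Finset.mem_filter.2 ⟨(hBm _).2 hb, h.symm⟩)
    simp [ev] at this
  have hsum : ∑ i : Fin d, (2 * g y2) < ∑ i : Fin d, (g (y3 + ev i) + g (y3 + -ev i)) := by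
    refine Finset.sum_lt_sum (fun i _ => ?_) ⟨i0, Finset.mem_univ _, ?_⟩
    · have hb := nbr_ball hint i
      linarith [hmin _ ((hBm _).2 hb.1), hmin _ ((hBm _).2 hb.2)]
    · have hb := nbr_ball hint i0
      linarith [hmin _ ((hBm _).2 hb.2)]
  have hd0 : (0 : ℝ) < d := by exact_mod_cast hd
  rw [hy3.2, avg, eq_comm, inv_mul_eq_iff_eq_mul₀ (by positivity)] at heq
  rw [heq] at hsum
  simp at hsum
  linarith

variable {Ω : Type*} [MeasurableSpace Ω] (W : SRW d Ω)

def CU (Z D0 : Finset (Zd d)) : Set (Zd d) := ⋃ z' ∈ (Z : Set (Zd d)), (z' + ·) '' (D0 : Set (Zd d))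

theorem mem_CU {Z D0 : Finset (Zd d)} {y : Zd d} : y ∈ CU Z D0 ↔ ∃ z ∈ Z, ∃ v ∈ D0, z + v = y := by
  simp only [CU, Set.mem_iUnion, Set.mem_image, Finset.mem_coe, exists_prop]

theorem eqm_nonneg (A : Set (Zd d)) (x : Zd d) : 0 ≤ W.eqm A x := by
  rw [SRW.eqm]; split_ifs
  · exact ENNReal.toReal_nonneg
  · exact le_rfl

theorem sep_uniq {L K : ℕ} (hL : 1 ≤ L) (hK : 3 ≤ K) {Z D0 : Finset (Zd d)}
    (hD : ∀ v ∈ D0, ∀ i, |v i| ≤ 4 * (L : ℤ))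
    (sep : ∀ z ∈ Z, ∀ z' ∈ Z, z ≠ z' → ∃ i, (2 * K + 3) * (L : ℤ) ≤ |z i - z' i|)
    {z z' v v' : Zd d} (hz : z ∈ Z) (hz' : z' ∈ Z) (hv : v ∈ D0) (hv' : v' ∈ D0) (h : z + v = z' + v') :
    z = z' := by
  by_contra hne
  obtain ⟨i, hi⟩ := sep z hz z' hz' hne
  have h1 := hD v hv i
  have h2 := hD v' hv' i
  have h3 := congrFun h i
  simp only [Pi.add_apply] at h3
  have h4 : (9 : ℤ) * L ≤ (2 * K + 3) * L := mul_le_mul_of_nonneg_right (by omega) (by positivity)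
  rw [abs_le] at h1 h2
  have h5 : |z i - z' i| ≤ 8 * L := by rw [abs_le]; constructor <;> linarith
  have : (1 : ℤ) ≤ L := by exact_mod_cast hL
  linarith

noncomputable def hE (A : Set (Zd d)) : E d :=
  mkE (hR W A) 1 (fun x => by rw [abs_of_nonneg (hR_nonneg W A x)]; exact hR_le W A x)

theorem hE_apply (A : Set (Zd d)) (y : Zd d) : hE W A y = hR W A y := rfl

theorem gen_apply (hd : 1 ≤ d) (A : Set (Zd d)) (y : Zd d) :
    ((∑ i, Ti (d := d) i) (hE W A) : E d) y = d * W.eqm A y := by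
  have hd0 : (0 : ℝ) < d := by exact_mod_cast hd
  have h1 : ((∑ i, Ti (d := d) i) (hE W A) : E d) y = d * (avg (hR W A) y - hR W A y) := by
    rw [sum_apply, ← evC_apply, map_sum]
    have : ∀ i : Fin d, evC y (Ti i (hE W A)) = 1 / 2 * (hR W A (y + ev i) + hR W A (y + -ev i)) - hR W A y := by
      intro i
      show (2 : ℝ) * ((Qi i (hE W A) : E d) y - hE W A y) = _
      rw [Qi_apply]
      simp only [hE_apply]
      ring
    rw [Finset.sum_congr rfl fun i _ => this i, Finset.sum_sub_distrib, ← Finset.mul_sum, avg]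
    simp only [Finset.sum_const, Finset.card_univ, Fintype.card_fin, nsmul_eq_mul]
    field_simp
  rw [h1]
  by_cases hy : y ∈ A
  · rw [hR_in W A y hy, eqm_in W hd A y hy, sub_zero]
  · rw [← hR_out W hd A y hy, SRW.eqm, if_neg hy]; ring

theorem mkCfg (hd : 1 ≤ d) {L K : ℕ} (hL : 1 ≤ L) (hK : 3 ≤ K) {Z D0 : Finset (Zd d)}
    (hD : ∀ v ∈ D0, ∀ i, |v i| ≤ 4 * (L : ℤ))
    (sep : ∀ z ∈ Z, ∀ z' ∈ Z, z ≠ z' → ∃ i, (2 * K + 3) * (L : ℤ) ≤ |z i - z' i|) :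
    Cfg d L K Z D0 (hE W (CU Z D0)) (fun y => d * W.eqm (CU Z D0) y) where
  hL := hL
  hD := hD
  sep := sep
  h0 := fun y => hR_nonneg W _ y
  h1 := fun y => hR_le W _ y
  e0 := fun y => mul_nonneg (by positivity) (eqm_nonneg W _ y)
  hT := by
    refine E.ext fun y => ?_
    rw [gen_apply W hd, ← Finset.sum_product', ← evC_apply, map_sum]
    simp only [map_smul, evC_apply, dl_apply, smul_eq_mul, mul_ite, mul_one, mul_zero]
    by_cases hy : y ∈ CU Z D0
    · obtain ⟨z, hz, v, hv, rfl⟩ := mem_CU.1 hy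
      rw [Finset.sum_eq_single (z, v)]
      · simp
      · rintro ⟨z', v'⟩ hp hne
        rw [Finset.mem_product] at hp
        refine if_neg fun h => hne ?_
        have : z = z' := sep_uniq hL hK hD sep hz hp.1 hv hp.2 (by simpa using h)
        subst this
        simpa [eq_comm] using h
      · intro h
        exact absurd (Finset.mem_product.2 ⟨hz, hv⟩) h
    · rw [Finset.sum_eq_zero, SRW.eqm, if_neg hy, mul_zero]
      rintro ⟨z', v'⟩ hp
      rw [Finset.mem_product] at hp
      refine if_neg fun h => hy (mem_CU.2 ⟨z', hp.1, v', hp.2, ?_⟩)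
      exact h.symm

end Aux11

namespace Aux11

variable {d : ℕ} {Ω : Type*} [MeasurableSpace Ω] (W : SRW d Ω)

theorem key (hd : 3 ≤ d) (δ : ℝ) (hδ : 0 < δ) (hδ1 : δ < 1) : ∃ K0 : ℕ, 3 ≤ K0 ∧
    ∀ (L K : ℕ) (Z D0 : Finset (Zd d)), 1 ≤ L → K0 ≤ K →
    (∀ v ∈ D0, ∀ i, |v i| ≤ 4 * (L : ℤ)) →
    (∀ z ∈ Z, ∀ z' ∈ Z, z ≠ z' → ∃ i, (2 * K + 3) * (L : ℤ) ≤ |z i - z' i|) →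
    ∀ z ∈ Z, (∀ v ∈ D0, W.eqm (CU {z} D0) (z + v) = 0) ∨ ∃ c : ℝ, 0 ≤ c ∧ ∀ v ∈ D0,
      (1 - δ) / (1 + δ) * c * W.eqm (CU {z} D0) (z + v) ≤ W.eqm (CU Z D0) (z + v) ∧
      W.eqm (CU Z D0) (z + v) ≤ (1 + δ) / (1 - δ) * c * W.eqm (CU {z} D0) (z + v) := by
  obtain ⟨M, hM8, K0, hMK, H⟩ := main_prop d hd δ hδ hδ1
  refine ⟨K0, by omega, ?_⟩
  intro L K Z D0 hL hK hD sep z hz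
  have hd1 : 1 ≤ d := by omega
  have hK3 : 3 ≤ K := by omega
  have hL' : (1 : ℤ) ≤ L := by exact_mod_cast hL
  have sep1 : ∀ y ∈ ({z} : Finset (Zd d)), ∀ z' ∈ ({z} : Finset (Zd d)), y ≠ z' →
      ∃ i, (2 * K + 3) * (L : ℤ) ≤ |y i - z' i| := by
    intro y hy z' hz' hne
    rw [Finset.mem_singleton] at hy hz'
    exact absurd (hy.trans hz'.symm) hne
  have cC := mkCfg W hd1 hL hK3 hD sep
  have cD := mkCfg W hd1 hL hK3 hD sep1
  obtain ⟨FC, hFC, HC⟩ := H L K Z D0 _ _ cC hK z hz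
  obtain ⟨FD, hFD, HD⟩ := H L K {z} D0 _ _ cD hK z (Finset.mem_singleton_self z)
  simp only [hE_apply] at HC HD
  set C := CU Z D0 with hC
  set D := CU {z} D0 with hDd
  set R : ℤ := M * L with hR'
  have hDC : D ⊆ C := by
    intro y hy
    obtain ⟨z', hz', v, hv, h⟩ := mem_CU.1 hy
    rw [Finset.mem_singleton] at hz'
    subst hz'
    exact mem_CU.2 ⟨_, hz, v, hv, h⟩
  have hCD : ∀ y, (∀ i, |y i - z i| < R) → y ∉ D → y ∉ C := by
    intro y hy hyD hyC
    obtain ⟨z', hz', v, hv, rfl⟩ := mem_CU.1 hyC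
    have hne : z' ≠ z := by
      rintro rfl
      exact hyD (mem_CU.2 ⟨_, Finset.mem_singleton_self _, v, hv, rfl⟩)
    obtain ⟨i, hi⟩ := sep z' hz' z hz hne
    have h1 := hD v hv i
    have h2 := hy i
    simp only [Pi.add_apply] at h2
    have h3 : |z' i - z i| ≤ |z' i + v i - z i| + |v i| := by
      calc |z' i - z i| = |(z' i + v i - z i) - v i| := by ring_nf
        _ ≤ _ := abs_sub _ _
    have h4 : ((M : ℤ) + 4) * L ≤ (2 * K + 3) * L := mul_le_mul_of_nonneg_right (by omega) (by positivity)
    rw [hR'] at h2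
    linarith
  have hin : ∀ v ∈ D0, ∀ i, |(z + v : Zd d) i - z i| < R := by
    intro v hv i
    have := hD v hv i
    simp only [Pi.add_apply, add_sub_cancel_left]
    have h4 : (8 : ℤ) * L ≤ M * L := mul_le_mul_of_nonneg_right (by omega) (by positivity)
    rw [hR']
    linarith
  have hvD : ∀ v ∈ D0, z + v ∈ D := fun v hv => mem_CU.2 ⟨_, Finset.mem_singleton_self _, v, hv, rfl⟩
  have general : ∀ a b : ℝ, (∀ y, (∀ i, |y i - z i| ≤ R) → (∃ i, |y i - z i| = R) →
      0 ≤ a * hR W C y + b * hR W D y) → ∀ v ∈ D0, 0 ≤ a * W.eqm C (z + v) + b * W.eqm D (z + v) := by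
    intro a b hsh v hv
    have hh := maxp hd1 (fun y => a * hR W C y + b * hR W D y) z R D
      (by
        intro y hy hyD
        rw [avg_lin, ← hR_out W hd1 D y hyD, ← hR_out W hd1 C y (hCD y hy hyD)])
      (by
        intro y hyD
        simp only [hR_in W D y hyD, hR_in W C y (hDC hyD)]
        simp) hsh
    have := avg_nonneg (hin v hv) _ hh
    rw [avg_lin, ← eqm_in W hd1 D _ (hvD v hv), ← eqm_in W hd1 C _ (hDC (hvD v hv))] at this
    exact this
  rcases hFD.eq_or_lt with h0 | hpos
  · left
    intro v hv
    have := general 0 (-1) (by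
      intro y hy hys
      have := (HD y hy hys).2
      rw [← h0] at this
      linarith) v hv
    have h2 := eqm_nonneg W D (z + v)
    linarith
  · right
    have e1 : 0 < 1 - δ := by linarith
    have e2 : 0 < 1 + δ := by linarith
    refine ⟨FC / FD, by positivity, fun v hv => ⟨?_, ?_⟩⟩
    · have := general 1 (-((1 - δ) / (1 + δ) * (FC / FD))) (by
        intro y hy hys
        have h1 := (HC y hy hys).1
        have h2 := (HD y hy hys).2
        have h3 : (1 - δ) / (1 + δ) * (FC / FD) * hR W D y ≤ (1 - δ) / (1 + δ) * (FC / FD) * ((1 + δ) * FD) :=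
          mul_le_mul_of_nonneg_left h2 (by positivity)
        have h4 : (1 - δ) / (1 + δ) * (FC / FD) * ((1 + δ) * FD) = (1 - δ) * FC := by field_simp
        linarith) v hv
      linarith
    · have := general (-1) ((1 + δ) / (1 - δ) * (FC / FD)) (by
        intro y hy hys
        have h1 := (HC y hy hys).2
        have h2 := (HD y hy hys).1
        have h3 : (1 + δ) / (1 - δ) * (FC / FD) * ((1 - δ) * FD) ≤ (1 + δ) / (1 - δ) * (FC / FD) * hR W D y :=
          mul_le_mul_of_nonneg_left h2 (by positivity)
        have h4 : (1 + δ) / (1 - δ) * (FC / FD) * ((1 - δ) * FD) = (1 + δ) * FC := by field_simp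
        linarith) v hv
      linarith

theorem CU_single (z : Zd d) (D0 : Finset (Zd d)) : CU {z} D0 = (z + ·) '' (D0 : Set (Zd d)) := by
  ext y
  rw [mem_CU]
  simp only [Finset.mem_singleton, exists_eq_left, Set.mem_image, Finset.mem_coe]

theorem cap_eq (z : Zd d) (D0 : Finset (Zd d)) :
    W.cap (CU {z} D0) = ∑ v ∈ D0, W.eqm (CU {z} D0) (z + v) := by
  rw [SRW.cap, finsum_eq_sum_of_support_subset (s := D0.image (z + ·)),
    Finset.sum_image (fun a _ b _ h => add_left_cancel h)]
  intro y hy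
  rw [Finset.mem_coe, Finset.mem_image]
  by_contra hc
  refine hy ?_
  rw [SRW.eqm, if_neg]
  intro h
  obtain ⟨z', hz', v, hv, rfl⟩ := mem_CU.1 h
  rw [Finset.mem_singleton] at hz'
  subst hz'
  exact hc ⟨v, hv, rfl⟩

theorem final (hd : 3 ≤ d) (ε : ℝ) (hε0 : 0 < ε) (hε1 : ε < 1) :
    ∃ c₅ : ℝ, ∀ (L K : ℕ), 1 ≤ L → c₅ ≤ (K : ℝ) →
      ∀ D₀ : Finset (Zd d), (D₀ : Set (Zd d)) ⊆ intBox (-(3 * L : ℤ)) (4 * L) →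
        ∀ Z : Finset (Zd d),
          (∀ z ∈ Z, ∀ z' ∈ Z, z ≠ z' → (2 * K + 3) * L ≤ supDist z z') →
          ∀ x : Zd d,
            (∑ z ∈ Z, (∑ y ∈ D₀, W.eqm (CU Z D₀) (z + y)) * W.ebar (CU {z} D₀) x)
              ≤ (1 + ε) * W.eqm (CU Z D₀) x := by
  obtain ⟨K0, hK03, H⟩ := key W hd (ε / 16) (by linarith) (by linarith)
  refine ⟨K0, ?_⟩
  intro L K hL hK D0 hbox Z hsep x
  have hK' : K0 ≤ K := by exact_mod_cast hK
  have hL' : (1 : ℤ) ≤ L := by exact_mod_cast hL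
  have hD : ∀ v ∈ D0, ∀ i, |v i| ≤ 4 * (L : ℤ) := by
    intro v hv i
    have := hbox hv i
    rw [abs_le]
    constructor <;> linarith [this.1, this.2]
  have sep : ∀ z ∈ Z, ∀ z' ∈ Z, z ≠ z' → ∃ i, (2 * K + 3) * (L : ℤ) ≤ |z i - z' i| := by
    intro z hz z' hz' hne
    have h1 := hsep z hz z' hz' hne
    rw [supDist, Finset.le_sup_iff (show 0 < (2 * K + 3) * L by positivity)] at h1
    obtain ⟨i, _, hi⟩ := h1
    refine ⟨i, ?_⟩
    rw [Int.abs_eq_natAbs]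
    exact_mod_cast hi
  have hzero : ∀ z ∈ Z, x ∉ CU {z} D0 → W.ebar (CU {z} D0) x = 0 := by
    intro z _ h
    rw [SRW.ebar, SRW.eqm, if_neg h, zero_div]
  by_cases hx : x ∈ CU Z D0
  · obtain ⟨z, hz, v, hv, rfl⟩ := mem_CU.1 hx
    rw [Finset.sum_eq_single z]
    · have hen : ∀ y, 0 ≤ W.eqm (CU {z} D0) y := eqm_nonneg W _
      rw [SRW.ebar, cap_eq]
      rcases H L K Z D0 hL hK' hD sep z hz with h0 | ⟨c, hc, h1⟩
      · rw [h0 v hv, zero_div, mul_zero]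
        have := eqm_nonneg W (CU Z D0) (z + v)
        positivity
      · set δ := ε / 16 with hδ
        have d0 : 0 < δ := by positivity
        have d1 : δ < 1 / 16 := by rw [hδ]; linarith
        have d2 : 0 < 1 - δ := by linarith
        have hr : (1 + δ) / (1 - δ) ≤ (1 + ε) * ((1 - δ) / (1 + δ)) := by
          rw [← mul_div_assoc, div_le_div_iff₀ d2 (by positivity)]
          have : ε = 16 * δ := by rw [hδ]; ring
          rw [this]
          nlinarith [mul_pos d0 d0, mul_pos (mul_pos d0 d0) d0]
        set b := (1 + δ) / (1 - δ) * c with hb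
        have hb0 : 0 ≤ b := by positivity
        set s := ∑ v ∈ D0, W.eqm (CU {z} D0) (z + v) with hs
        have hs0 : 0 ≤ s := Finset.sum_nonneg fun v _ => hen _
        have hsum : ∑ y ∈ D0, W.eqm (CU Z D0) (z + y) ≤ b * s := by
          rw [hs, Finset.mul_sum]
          exact Finset.sum_le_sum fun v hv => (h1 v hv).2
        have hev := hen (z + v)
        calc _ ≤ b * s * (W.eqm (CU {z} D0) (z + v) / s) := by gcongr
          _ ≤ b * W.eqm (CU {z} D0) (z + v) := by
              rcases hs0.eq_or_lt with h | h
              · rw [← h]; simp; positivity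
              · apply le_of_eq; field_simp
          _ ≤ (1 + ε) * ((1 - δ) / (1 + δ)) * c * W.eqm (CU {z} D0) (z + v) := by
              rw [hb]; gcongr
          _ = (1 + ε) * ((1 - δ) / (1 + δ) * c * W.eqm (CU {z} D0) (z + v)) := by ring
          _ ≤ _ := mul_le_mul_of_nonneg_left (h1 v hv).1 (by linarith)
    · intro z' hz' hne
      rw [hzero z' hz', mul_zero]
      intro h
      obtain ⟨z'', hz'', v', hv', hh⟩ := mem_CU.1 h
      rw [Finset.mem_singleton] at hz''
      subst hz''
      exact hne (sep_uniq hL (by omega) hD sep hz' hz hv' hv hh)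
    · intro h; exact absurd hz h
  · rw [Finset.sum_eq_zero, SRW.eqm, if_neg hx, mul_zero]
    intro z hz
    rw [hzero z hz, mul_zero]
    intro h
    refine hx ?_
    obtain ⟨z'', hz'', v', hv', hh⟩ := mem_CU.1 h
    rw [Finset.mem_singleton] at hz''
    subst hz''
    exact mem_CU.2 ⟨_, hz, v', hv', hh⟩

end Aux11

/-- (3.6) in the proof of Proposition 3.1: `V ≤ (1+ε)·e_C`, where
`C = ∪_{z∈𝒞} D_z` and `V = Σ_{z∈𝒞} e_C(D_z)·ē_{D_z}`. -/
theorem statement11 {d : ℕ} (hd : 3 ≤ d) {Ω : Type*} [MeasurableSpace Ω] (W : SRW d Ω)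
    (ε : ℝ) (hε0 : 0 < ε) (hε1 : ε < 1) :
    ∃ c₅ : ℝ, ∀ (L K : ℕ), 1 ≤ L → c₅ ≤ (K : ℝ) → 100 ≤ K →
      ∀ D₀ : Finset (Zd d), isBox (D₀ : Set (Zd d)) →
        (intBox 0 (L : ℤ) : Set (Zd d)) ⊆ (D₀ : Set (Zd d)) →
        (D₀ : Set (Zd d)) ⊆ intBox (-(3 * L : ℤ)) (4 * L) →
        ∀ 𝒞 : Finset (Zd d), 𝒞.Nonempty →
          (∀ z ∈ 𝒞, ∀ i, (L : ℤ) ∣ z i) →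
          (∀ z ∈ 𝒞, ∀ z' ∈ 𝒞, z ≠ z' → (2 * K + 3) * L ≤ supDist z z') →
          ∀ x : Zd d,
            (∑ z ∈ 𝒞,
                (∑ y ∈ D₀,
                    W.eqm (⋃ z' ∈ (𝒞 : Set (Zd d)), (z' + ·) '' (D₀ : Set (Zd d)))
                      (z + y)) *
                  W.ebar ((z + ·) '' (D₀ : Set (Zd d))) x)
              ≤ (1 + ε) *
                W.eqm (⋃ z' ∈ (𝒞 : Set (Zd d)), (z' + ·) '' (D₀ : Set (Zd d))) x := by
  obtain ⟨c, hc⟩ := Aux11.final W hd ε hε0 hε1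
  refine ⟨c, ?_⟩
  intro L K hL hK _ D₀ _ _ hbox 𝒞 _ _ hsep x
  have := hc L K hL hK D₀ hbox 𝒞 hsep x
  simp only [Aux11.CU_single] at this
  exact this
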